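/- Putinar's Positivstellensatz for trace polynomials: Let Q ⊆ Sym TT_n be an archimedean cyclic quadratic module and a ∈ Sym TT_n. If a(X) is positive definite for every X ∈ K_Q, then a ∈ Q. -/

import Mathlib

noncomputable section

open Matrix

/-- The polynomial ring ℝ[ξ] in the g·n² commuting variables ξ_{jıȷ}. -/
abbrev PolyRing (n g : ℕ) : Type := MvPolynomial (Fin g × Fin n × Fin n) ℝ

/-- n×n matrices over ℝ[ξ]. -/
abbrev MatP (n g : ℕ) : Type := Matrix (Fin n) (Fin n) (PolyRing n g)

/-- The generic matrices Ξ_j = (ξ_{jıȷ})_{ıȷ}. -/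
def genMat (n g : ℕ) (j : Fin g) : MatP n g :=
  Matrix.of fun a b => MvPolynomial.X (j, a, b)

/-- The set of generic matrices together with their transposes. -/
def genSet (n g : ℕ) : Set (MatP n g) :=
  Set.range (genMat n g) ∪ Set.range (fun j => (genMat n g j)ᵀ)

/-- The trace ring TT_n: the ℝ-subalgebra of M_n(ℝ[ξ]) generated by the Ξ_j, their
transposes, and the scalar matrices tr(w)·1 for all products w of the Ξ_j, Ξ_jᵀ. -/
def traceRing (n g : ℕ) : Subalgebra ℝ (MatP n g) :=
  Algebra.adjoin ℝ
    (genSet n g ∪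
      {m | ∃ w ∈ Submonoid.closure (genSet n g), m = (Matrix.trace w) • (1 : MatP n g)})

/-- The center C_n of the trace ring: the scalar matrices in TT_n. -/
def centerSet (n g : ℕ) : Set (MatP n g) :=
  {c | c ∈ traceRing n g ∧ ∃ p : PolyRing n g, c = p • (1 : MatP n g)}

/-- Evaluation of a matrix of polynomials at a g-tuple X of n×n real matrices. -/
def evalMat (n g : ℕ) (X : Fin g → Matrix (Fin n) (Fin n) ℝ) (h : MatP n g) :
    Matrix (Fin n) (Fin n) ℝ :=
  h.map (MvPolynomial.eval fun v => X v.1 v.2.1 v.2.2)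

/-- The semialgebraic set K_S determined by S. -/
def KSet (n g : ℕ) (S : Set (MatP n g)) : Set (Fin g → Matrix (Fin n) (Fin n) ℝ) :=
  {X | ∀ s ∈ S, (evalMat n g X s).PosSemidef}

/-- Cyclic quadratic module in Sym TT_n. -/
def IsCyclicQM (n g : ℕ) (Q : Set (MatP n g)) : Prop :=
  (∀ q ∈ Q, q ∈ traceRing n g ∧ qᵀ = q) ∧
  (1 : MatP n g) ∈ Q ∧
  (∀ a ∈ Q, ∀ b ∈ Q, a + b ∈ Q) ∧
  (∀ h ∈ traceRing n g, ∀ q ∈ Q, h * q * hᵀ ∈ Q) ∧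
  (∀ q ∈ Q, (Matrix.trace q) • (1 : MatP n g) ∈ Q)

/-- Cyclic preordering: a cyclic quadratic module whose intersection with the center
is closed under multiplication. -/
def IsCyclicPreordering (n g : ℕ) (T : Set (MatP n g)) : Prop :=
  IsCyclicQM n g T ∧
  ∀ a ∈ T ∩ centerSet n g, ∀ b ∈ T ∩ centerSet n g, a * b ∈ T

/-- The smallest cyclic preordering T_S^tr containing S. -/
def TtrS (n g : ℕ) (S : Set (MatP n g)) : Set (MatP n g) :=
  {a | ∀ T : Set (MatP n g), IsCyclicPreordering n g T → S ⊆ T → a ∈ T}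

namespace Matrix

/-- Jacobi's formula for the derivative of the determinant of a matrix of polynomials. -/
theorem derivative_det_eq_trace {ι R : Type*} [Fintype ι] [DecidableEq ι] [CommRing R]
    (M : Matrix ι ι (Polynomial R)) :
    Polynomial.derivative M.det = trace (M.adjugate * M.map Polynomial.derivative) := by
  have h1 : ∀ i, (M.updateCol i fun k => Polynomial.derivative (M k i)).det =
      ∑ j, M.adjugate i j * Polynomial.derivative (M j i) := by
    intro i
    rw [← cramer_apply, cramer_eq_adjugate_mulVec]
    rfl
  have h2 : trace (M.adjugate * M.map Polynomial.derivative) =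
      ∑ i, (M.updateCol i fun k => Polynomial.derivative (M k i)).det := by
    simp_rw [h1]
    rfl
  rw [h2, det_apply']
  simp_rw [det_apply']
  rw [Finset.sum_comm, Polynomial.derivative_sum]
  refine Finset.sum_congr rfl fun σ _ => ?_
  rw [Polynomial.derivative_mul, Polynomial.derivative_intCast, zero_mul, zero_add,
    Polynomial.derivative_prod_finset, Finset.mul_sum]
  refine Finset.sum_congr rfl fun i _ => ?_
  congr 1
  rw [← Finset.prod_erase_mul _ _ (Finset.mem_univ i)]
  congr 1
  · refine Finset.prod_congr rfl fun k hk => ?_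
    rw [updateCol_ne (Finset.ne_of_mem_erase hk)]
  · rw [updateCol_self]

/-- The polynomial `det (1 + X • h)`. -/
def detOneAdd {ι R : Type*} [Fintype ι] [DecidableEq ι] [CommRing R] (h : Matrix ι ι R) :
    Polynomial R :=
  det (1 + (Polynomial.X : Polynomial R) • h.map Polynomial.C)

/-- The alternating generating series of the traces of the powers of `h`. -/
def traceSeries {ι R : Type*} [Fintype ι] [DecidableEq ι] [CommRing R] (h : Matrix ι ι R) :
    PowerSeries R :=
  PowerSeries.mk fun i => (-1) ^ i * trace (h ^ (i + 1))

theorem derivative_detOneAdd {ι R : Type*} [Fintype ι] [DecidableEq ι] [CommRing R]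
    (h : Matrix ι ι R) :
    ((Polynomial.derivative (detOneAdd h) : Polynomial R) : PowerSeries R) =
      (detOneAdd h : PowerSeries R) * traceSeries h := by
  set H : Matrix ι ι (Polynomial R) := h.map Polynomial.C with hH
  set A : Matrix ι ι (Polynomial R) := 1 + (Polynomial.X : Polynomial R) • H with hA
  set D := detOneAdd h with hD
  have hDA : A.det = D := rfl
  have hder : A.map Polynomial.derivative = H := by
    ext1 i j
    simp [hA, hH, Matrix.one_apply, apply_ite]
  have hjac : Polynomial.derivative D = trace (A.adjugate * H) := by
    rw [← hDA, derivative_det_eq_trace, hder]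
  have hmul : A.adjugate * A = D • (1 : Matrix ι ι (Polynomial R)) := by
    rw [adjugate_mul, hDA]
  have htrpow : ∀ k, trace (H ^ k) = Polynomial.C (trace (h ^ k)) := by
    intro k
    have : H ^ k = (h ^ k).map Polynomial.C := by
      rw [hH]; exact (map_pow (Polynomial.C.mapMatrix) h k).symm
    rw [this]
    simp [trace]
  have hstep : ∀ k, trace (A.adjugate * H ^ (k + 1)) =
      D * Polynomial.C (trace (h ^ (k + 1))) -
        Polynomial.X * trace (A.adjugate * H ^ (k + 2)) := by
    intro k
    have h1 : A.adjugate * A * H ^ (k + 1) = D • H ^ (k + 1) := by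
      rw [hmul, smul_mul_assoc, one_mul]
    have h2 : A.adjugate * A * H ^ (k + 1) =
        A.adjugate * H ^ (k + 1) + (Polynomial.X : Polynomial R) • (A.adjugate * H ^ (k + 2)) := by
      rw [hA, mul_add, mul_one, add_mul, mul_smul_comm, smul_mul_assoc, mul_assoc, ← pow_succ']
    have h3 := congrArg trace (h2.symm.trans h1)
    rw [trace_add, trace_smul, trace_smul, htrpow, smul_eq_mul, smul_eq_mul] at h3
    linear_combination h3
  have hiter : ∀ k, trace (A.adjugate * H) =
      D * (∑ i ∈ Finset.range k, Polynomial.C ((-1) ^ i * trace (h ^ (i + 1))) * Polynomial.X ^ i)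
        + (-1) ^ k * Polynomial.X ^ k * trace (A.adjugate * H ^ (k + 1)) := by
    intro k
    induction k with
    | zero => simp
    | succ k ih =>
      rw [ih, hstep, Finset.sum_range_succ]
      simp only [map_mul, map_pow, map_neg, map_one]
      ring
  ext k
  rw [Polynomial.coeff_coe, hjac, hiter (k + 1), Polynomial.coeff_add]
  rw [show (-1 : Polynomial R) ^ (k + 1) * Polynomial.X ^ (k + 1) *
    trace (A.adjugate * H ^ (k + 1 + 1)) = ((-1) ^ (k + 1) *
    trace (A.adjugate * H ^ (k + 1 + 1))) * Polynomial.X ^ (k + 1) by ring,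
    Polynomial.coeff_mul_X_pow', if_neg (by omega), add_zero, PowerSeries.coeff_mul,
    Polynomial.coeff_mul]
  refine Finset.sum_congr rfl fun p hp => ?_
  have hle : p.2 < k + 1 := by
    have := Finset.HasAntidiagonal.mem_antidiagonal.mp hp
    omega
  rw [Polynomial.coeff_coe, traceSeries, PowerSeries.coeff_mk, Polynomial.finsetSum_coeff]
  simp only [Polynomial.coeff_C_mul, Polynomial.coeff_X_pow, mul_ite, mul_one, mul_zero,
    Finset.sum_ite_eq, Finset.mem_range, hle, if_true]

theorem detOneAdd_coeff_zero {ι R : Type*} [Fintype ι] [DecidableEq ι] [CommRing R]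
    (h : Matrix ι ι R) : (detOneAdd h).coeff 0 = 1 := by
  rw [detOneAdd, Polynomial.coeff_zero_eq_eval_zero, eval_det_add_X_smul, det_one,
    Polynomial.eval_one]

/-- The determinant of an alternating matrix over a field is a square. -/
theorem isSquare_det_of_transpose_eq_neg {F : Type*} [Field F] (h2 : (2 : F) ≠ 0) (N : ℕ) :
    ∀ {ι : Type} [Fintype ι] [DecidableEq ι], Fintype.card ι = N →
      ∀ A : Matrix ι ι F, Aᵀ = -A → IsSquare A.det := by
  induction N using Nat.strong_induction_on with
  | _ N ih =>
  intro ι _ _ hcard A hA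
  have hAij : ∀ i j, A j i = - A i j := fun i j => congrFun (congrFun hA i) j
  have hdiag : ∀ i, A i i = 0 := by
    intro i
    have h3 : (2 : F) * A i i = 0 := by linear_combination hAij i i
    exact (mul_eq_zero.mp h3).resolve_left h2
  by_cases hzero : A = 0
  · rcases isEmpty_or_nonempty ι with hι | hι
    · rw [det_isEmpty]; exact IsSquare.one
    · rw [hzero, det_zero]; exact IsSquare.zero
  obtain ⟨i, j, hij⟩ : ∃ i j, A i j ≠ 0 := by
    by_contra! hcon
    exact hzero (by ext i j; exact hcon i j)
  have hne : i ≠ j := fun hh => hij (by rw [hh]; exact hdiag j)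
  let p : ι → Prop := fun k => k = i ∨ k = j
  let e : {k // p k} ⊕ {k // ¬ p k} ≃ ι := Equiv.sumCompl p
  set A₁ := A.submatrix (fun k : {k // p k} => (k : ι)) (fun k : {k // p k} => (k : ι))
  set A₂ := A.submatrix (fun k : {k // p k} => (k : ι)) (fun k : {k // ¬ p k} => (k : ι)) with hA₂
  set A₃ := A.submatrix (fun k : {k // ¬ p k} => (k : ι)) (fun k : {k // p k} => (k : ι)) with hA₃
  set A₄ := A.submatrix (fun k : {k // ¬ p k} => (k : ι)) (fun k : {k // ¬ p k} => (k : ι))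
  have hblocks : A.submatrix e e = fromBlocks A₁ A₂ A₃ A₄ := by
    ext (x | x) (y | y) <;> rfl
  let f : Fin 2 ≃ {k // p k} :=
    Equiv.ofBijective ![⟨i, Or.inl rfl⟩, ⟨j, Or.inr rfl⟩] (by
      constructor
      · intro x y hxy
        fin_cases x <;> fin_cases y
        · rfl
        · exact absurd (congrArg Subtype.val hxy) hne
        · exact absurd (congrArg Subtype.val hxy) hne.symm
        · rfl
      · rintro ⟨k, rfl | rfl⟩
        · exact ⟨0, rfl⟩
        · exact ⟨1, rfl⟩)
  have hdet1 : A₁.det = A i j * A i j := by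
    rw [← det_submatrix_equiv_self f, det_fin_two]
    have e1 : A₁.submatrix f f 0 0 = A i i := rfl
    have e2 : A₁.submatrix f f 0 1 = A i j := rfl
    have e3 : A₁.submatrix f f 1 0 = A j i := rfl
    have e4 : A₁.submatrix f f 1 1 = A j j := rfl
    rw [e1, e2, e3, e4, hdiag, hdiag, hAij i j]
    ring
  have hunit : IsUnit A₁.det := by
    rw [hdet1]; exact (mul_ne_zero hij hij).isUnit
  have : Invertible A₁ := A₁.invertibleOfIsUnitDet hunit
  have hT1 : A₁ᵀ = -A₁ := by ext x y; exact hAij _ _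
  have hT4 : A₄ᵀ = -A₄ := by ext x y; exact hAij _ _
  have hT2 : A₂ᵀ = -A₃ := by ext x y; exact hAij _ _
  have hT3 : A₃ᵀ = -A₂ := by ext x y; exact hAij _ _
  have hinv : (A₁⁻¹)ᵀ = -A₁⁻¹ := by
    rw [transpose_nonsing_inv, hT1]
    exact inv_eq_left_inv (by rw [neg_mul_neg, nonsing_inv_mul _ hunit])
  rw [← det_submatrix_equiv_self e, hblocks, det_fromBlocks₁₁, hdet1, invOf_eq_nonsing_inv]
  refine IsSquare.mul ⟨_, rfl⟩ (ih (Fintype.card {k // ¬ p k}) ?_ rfl _ ?_)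
  · rw [← hcard]
    exact Fintype.card_subtype_lt (x := i) (by simp [p])
  · rw [transpose_sub, transpose_mul, transpose_mul, hT2, hT3, hT4, hinv]
    simp only [Matrix.mul_neg, Matrix.neg_mul, neg_neg, Matrix.mul_assoc]
    abel

theorem exists_sq_eq_detOneAdd_mul {ι : Type} {R : Type*} [Fintype ι] [DecidableEq ι]
    [CommRing R] [IsDomain R] [UniqueFactorizationMonoid R] [CharZero R]
    (s t : Matrix ι ι R) (hs : sᵀ = -s) (ht : tᵀ = -t) :
    ∃ q : Polynomial R, q.coeff 0 = 1 ∧ detOneAdd (s * t) = q ^ 2 := by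
  let F := FractionRing (Polynomial R)
  let S : Matrix ι ι (Polynomial R) := s.map Polynomial.C
  let T : Matrix ι ι (Polynomial R) := t.map Polynomial.C
  have hS : Sᵀ = -S := by
    ext1 i j
    have := congrFun (congrFun hs i) j
    simp only [transpose_apply, neg_apply] at this
    simp [S, this]
  have hT : Tᵀ = -T := by
    ext1 i j
    have := congrFun (congrFun ht i) j
    simp only [transpose_apply, neg_apply] at this
    simp [T, this]
  let M : Matrix (ι ⊕ ι) (ι ⊕ ι) (Polynomial R) :=
    fromBlocks S (-1) 1 ((Polynomial.X : Polynomial R) • T)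
  have hM : Mᵀ = -M := by
    simp only [M, fromBlocks_transpose, fromBlocks_neg, transpose_smul, hS, hT, transpose_neg,
      transpose_one, smul_neg, neg_neg]
  have hdet : M.det = detOneAdd (s * t) := by
    have h1 : fromBlocks S (-1) 1 ((Polynomial.X : Polynomial R) • T) *
        fromBlocks 0 1 (-1) 0 = fromBlocks 1 S (-((Polynomial.X : Polynomial R) • T)) 1 := by
      simp [fromBlocks_multiply]
    have h3 : (fromBlocks 0 1 (-1) 0 : Matrix (ι ⊕ ι) (ι ⊕ ι) (Polynomial R)) =
        fromBlocks 1 1 0 1 * fromBlocks 1 0 (-1) 1 * fromBlocks 1 1 0 1 := by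
      simp [fromBlocks_multiply]
    have h4 : (fromBlocks 0 1 (-1) 0 : Matrix (ι ⊕ ι) (ι ⊕ ι) (Polynomial R)).det = 1 := by
      simp [h3, det_mul]
    have h5 : (s * t).map Polynomial.C = S * T := by
      simp only [S, T, Matrix.map_mul]
    have h6 := congrArg det h1
    rw [det_mul, h4, mul_one, det_fromBlocks_one₂₂, mul_neg, sub_neg_eq_add, mul_smul_comm] at h6
    rw [detOneAdd, h5]
    exact h6
  have hsq : IsSquare (algebraMap (Polynomial R) F M.det) := by
    rw [RingHom.map_det]
    refine isSquare_det_of_transpose_eq_neg (two_ne_zero) _ rfl _ ?_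
    rw [RingHom.mapMatrix_apply, ← transpose_map, hM]
    ext i j; simp
  obtain ⟨r, hr⟩ := hsq
  have hint : IsIntegral (Polynomial R) r := by
    refine IsIntegral.of_pow (n := 2) two_pos ?_
    rw [pow_two, ← hr]
    exact isIntegral_algebraMap
  obtain ⟨q, rfl⟩ := IsIntegrallyClosed.isIntegral_iff.mp hint
  have hq : detOneAdd (s * t) = q ^ 2 := by
    rw [← hdet, pow_two]
    apply IsFractionRing.injective (Polynomial R) F
    rw [hr, map_mul]
  have h0 : q.coeff 0 * q.coeff 0 = 1 := by
    rw [← Polynomial.mul_coeff_zero, ← pow_two, ← hq, detOneAdd_coeff_zero]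
  rcases mul_self_eq_one_iff.mp h0 with h | h
  · exact ⟨q, h, hq⟩
  · exact ⟨-q, by simp [h], by rw [hq, neg_sq]⟩

end Matrix

theorem PowerSeries.coeff_succ_of_derivative_eq_mul {R : Type*} [CommRing R] {D : Polynomial R}
    {S : PowerSeries R}
    (h : ((Polynomial.derivative D : Polynomial R) : PowerSeries R) = (D : PowerSeries R) * S)
    (k : ℕ) : ((k : R) + 1) * D.coeff (k + 1) =
      ∑ p ∈ Finset.HasAntidiagonal.antidiagonal k, D.coeff p.1 * PowerSeries.coeff p.2 S := by
  have h1 := congrArg (PowerSeries.coeff k) h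
  rw [Polynomial.coeff_coe, Polynomial.coeff_derivative, PowerSeries.coeff_mul] at h1
  rw [mul_comm, h1]
  simp

/-- Solutions of `D' = D * S` specialise along real points of a subalgebra containing the
coefficients of `S`. -/
theorem exists_real_logDeriv {R : Type*} [CommRing R] [Algebra ℝ R] (C : Subalgebra ℝ R)
    (χ : C →ₐ[ℝ] ℝ) (D : Polynomial R) (S : PowerSeries R) (hD0 : D.coeff 0 = 1)
    (hS : ∀ i, PowerSeries.coeff i S ∈ C)
    (h : ((Polynomial.derivative D : Polynomial R) : PowerSeries R) = (D : PowerSeries R) * S) :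
    ∃ hC : ∀ k, D.coeff k ∈ C, ∃ E : Polynomial ℝ, (∀ k, E.coeff k = χ ⟨D.coeff k, hC k⟩) ∧
      E.coeff 0 = 1 ∧
      ((Polynomial.derivative E : Polynomial ℝ) : PowerSeries ℝ) =
        (E : PowerSeries ℝ) * PowerSeries.mk fun i => χ ⟨PowerSeries.coeff i S, hS i⟩ := by
  have hC : ∀ k, D.coeff k ∈ C := by
    intro k
    induction k using Nat.strong_induction_on with
    | _ k ih =>
    rcases k with _ | k
    · rw [hD0]; exact C.one_mem
    · have h1 := PowerSeries.coeff_succ_of_derivative_eq_mul h k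
      have h2 : D.coeff (k + 1) = ((k : ℝ) + 1)⁻¹ • (((k : R) + 1) * D.coeff (k + 1)) := by
        have h3 : ((k : R) + 1) = algebraMap ℝ R ((k : ℝ) + 1) := by simp
        rw [h3, ← Algebra.smul_def, smul_smul, inv_mul_cancel₀ (by positivity), one_smul]
      rw [h2, h1]
      refine C.smul_mem (C.sum_mem fun p hp => C.mul_mem (ih _ ?_) (hS _)) _
      have := Finset.HasAntidiagonal.mem_antidiagonal.mp hp
      omega
  refine ⟨hC, ?_⟩
  obtain ⟨D', hD'⟩ : ∃ D' : Polynomial C, D'.map C.val.toRingHom = D := by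
    have : D ∈ Polynomial.lifts C.val.toRingHom := by
      rw [Polynomial.lifts_iff_coeff_lifts]
      intro k
      exact ⟨⟨_, hC k⟩, rfl⟩
    exact (Polynomial.mem_lifts _).mp this
  have hco : ∀ k, D'.coeff k = ⟨D.coeff k, hC k⟩ := by
    intro k
    apply Subtype.ext
    have h1 := congrArg (fun P => P.coeff k) hD'
    simp only [Polynomial.coeff_map] at h1
    exact h1
  have hEc : ∀ k, (D'.map χ.toRingHom).coeff k = χ ⟨D.coeff k, hC k⟩ := by
    intro k
    rw [Polynomial.coeff_map, hco]
    rfl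
  refine ⟨D'.map χ.toRingHom, hEc, ?_, ?_⟩
  · rw [hEc]
    have : (⟨D.coeff 0, hC 0⟩ : C) = 1 := Subtype.ext hD0
    rw [this, map_one]
  · ext k
    have h1 := congrArg (PowerSeries.coeff k) h
    rw [Polynomial.coeff_coe, Polynomial.coeff_derivative, PowerSeries.coeff_mul] at h1
    rw [Polynomial.coeff_coe, Polynomial.coeff_derivative, PowerSeries.coeff_mul, hEc]
    have h2 : (⟨D.coeff (k + 1), hC _⟩ : C) * ((k : C) + 1) =
        ∑ p ∈ Finset.HasAntidiagonal.antidiagonal k, (⟨D.coeff p.1, hC _⟩ : C) *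
          ⟨PowerSeries.coeff p.2 S, hS _⟩ := by
      apply Subtype.ext
      simpa using h1
    have h3 := congrArg χ h2
    rw [map_mul, map_add, map_one, map_natCast, map_sum] at h3
    rw [h3]
    refine Finset.sum_congr rfl fun p _ => ?_
    rw [map_mul, Polynomial.coeff_coe, hEc, PowerSeries.coeff_mk]

theorem Polynomial.exists_nat_of_logDeriv_const {E : Polynomial ℝ} {T : PowerSeries ℝ} {m : ℝ}
    (h0 : E.coeff 0 = 1)
    (h : ((Polynomial.derivative E : Polynomial ℝ) : PowerSeries ℝ) = (E : PowerSeries ℝ) * T)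
    (hT : ∀ i, PowerSeries.coeff i T = (-1) ^ i * m) : ∃ k : ℕ, m = k := by
  by_contra! hcon
  have hmul : (1 + PowerSeries.X) * T = PowerSeries.C m := by
    ext (_ | i)
    · rw [add_mul, one_mul, map_add, hT, PowerSeries.coeff_zero_X_mul, PowerSeries.coeff_zero_C]
      simp
    · rw [add_mul, one_mul, map_add, hT, PowerSeries.coeff_succ_X_mul, hT, PowerSeries.coeff_C,
        if_neg (Nat.succ_ne_zero i)]
      ring
  have h1 : (1 + PowerSeries.X) * ((Polynomial.derivative E : Polynomial ℝ) : PowerSeries ℝ) =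
      PowerSeries.C m * (E : PowerSeries ℝ) := by
    rw [h, ← hmul]; ring
  have hrec : ∀ k : ℕ, ((k : ℝ) + 1) * E.coeff (k + 1) = (m - k) * E.coeff k := by
    intro k
    have h2 := congrArg (PowerSeries.coeff k) h1
    rw [add_mul, one_mul, map_add, PowerSeries.coeff_C_mul, Polynomial.coeff_coe,
      Polynomial.coeff_coe, Polynomial.coeff_derivative] at h2
    rcases k with _ | k
    · simp at h2 ⊢; linarith
    · rw [PowerSeries.coeff_succ_X_mul, Polynomial.coeff_coe, Polynomial.coeff_derivative] at h2
      push_cast at h2 ⊢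
      linarith
  have hne : ∀ k, E.coeff k ≠ 0 := by
    intro k
    induction k with
    | zero => rw [h0]; exact one_ne_zero
    | succ k ih =>
      intro hz
      have h3 := hrec k
      rw [hz, mul_zero] at h3
      exact mul_ne_zero (sub_ne_zero.mpr (hcon k)) ih h3.symm
  exact hne _ (Polynomial.coeff_natDegree_succ_eq_zero (p := E))

theorem Polynomial.exists_even_of_logDeriv {E : Polynomial ℝ} {T : PowerSeries ℝ} {c : ℝ}
    (h0 : E.coeff 0 = 1)
    (h : ((Polynomial.derivative E : Polynomial ℝ) : PowerSeries ℝ) = (E : PowerSeries ℝ) * T)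
    (hT0 : PowerSeries.coeff 0 T = 0) (hT1 : PowerSeries.coeff 1 T = c)
    (hT : ∀ i, PowerSeries.coeff (i + 2) T = - PowerSeries.coeff i T) :
    ∃ k : ℕ, c = 2 * k := by
  by_contra! hcon
  have hmul : (1 + PowerSeries.X * PowerSeries.X) * T = PowerSeries.C c * PowerSeries.X := by
    ext (_ | _ | i)
    · rw [add_mul, one_mul, map_add, hT0, mul_assoc, PowerSeries.coeff_zero_X_mul,
        PowerSeries.coeff_C_mul, PowerSeries.coeff_zero_X]
      simp
    · rw [add_mul, one_mul, map_add, zero_add, hT1, mul_assoc, PowerSeries.coeff_C_mul,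
        PowerSeries.coeff_one_X, ← zero_add 1, PowerSeries.coeff_succ_X_mul,
        PowerSeries.coeff_zero_X_mul]
      simp
    · rw [add_mul, one_mul, map_add, hT, mul_assoc, PowerSeries.coeff_C_mul, PowerSeries.coeff_X,
        PowerSeries.coeff_succ_X_mul, PowerSeries.coeff_succ_X_mul, if_neg (by omega)]
      ring
  have h1 : (1 + PowerSeries.X * PowerSeries.X) *
      ((Polynomial.derivative E : Polynomial ℝ) : PowerSeries ℝ) =
      PowerSeries.C c * (PowerSeries.X * (E : PowerSeries ℝ)) := by
    rw [h, ← mul_assoc (PowerSeries.C c), ← hmul]; ring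
  have hrec : ∀ k : ℕ, ((k : ℝ) + 2) * E.coeff (k + 2) = (c - k) * E.coeff k := by
    intro k
    have h2 := congrArg (PowerSeries.coeff (k + 1)) h1
    rw [add_mul, one_mul, map_add, PowerSeries.coeff_C_mul, Polynomial.coeff_coe,
      PowerSeries.coeff_succ_X_mul, mul_assoc, PowerSeries.coeff_succ_X_mul,
      Polynomial.coeff_coe, Polynomial.coeff_derivative] at h2
    rcases k with _ | k
    · simp at h2 ⊢; linarith
    · rw [PowerSeries.coeff_succ_X_mul, Polynomial.coeff_coe, Polynomial.coeff_derivative] at h2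
      push_cast at h2 ⊢
      linarith
  have hne : ∀ k, E.coeff (2 * k) ≠ 0 := by
    intro k
    induction k with
    | zero => rw [mul_zero, h0]; exact one_ne_zero
    | succ k ih =>
      intro hz
      have h3 := hrec (2 * k)
      rw [show 2 * k + 2 = 2 * (k + 1) by ring, hz, mul_zero] at h3
      refine mul_ne_zero (sub_ne_zero.mpr ?_) ih h3.symm
      push_cast
      exact hcon k
  exact hne (E.natDegree + 1) (Polynomial.coeff_eq_zero_of_natDegree_lt (by omega))

section TraceIdentities

variable {ι R : Type} [Fintype ι] [DecidableEq ι] [CommRing R] [Algebra ℝ R]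
  (C : Subalgebra ℝ R) (χ : C →ₐ[ℝ] ℝ)

theorem exists_nat_of_trace_pow_const (h : Matrix ι ι R) (m : ℝ)
    (htr : ∀ i, ∃ hi : trace (h ^ (i + 1)) ∈ C, χ ⟨_, hi⟩ = m) : ∃ k : ℕ, m = k := by
  choose hmem hval using htr
  have hS : ∀ i, PowerSeries.coeff i (traceSeries h) ∈ C := by
    intro i
    rw [traceSeries, PowerSeries.coeff_mk]
    exact C.mul_mem (C.pow_mem (C.neg_mem C.one_mem) _) (hmem i)
  obtain ⟨_, E, -, hE0, hE⟩ := exists_real_logDeriv C χ _ _ (detOneAdd_coeff_zero h) hS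
    (derivative_detOneAdd h)
  refine Polynomial.exists_nat_of_logDeriv_const hE0 hE fun i => ?_
  rw [PowerSeries.coeff_mk, ← hval i, ← map_one χ, ← map_neg, ← map_pow, ← map_mul]
  congr 1
  apply Subtype.ext
  simp [traceSeries]

theorem exists_even_of_trace_pow (h : Matrix ι ι R) (m : ℝ)
    (hmem : ∀ i, trace (h ^ (i + 1)) ∈ C) (h1 : χ ⟨_, hmem 0⟩ = 0) (h2 : χ ⟨_, hmem 1⟩ = -m)
    (hval : ∀ i, χ ⟨_, hmem (i + 2)⟩ = - χ ⟨_, hmem i⟩) : ∃ k : ℕ, m = 2 * k := by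
  have hS : ∀ i, PowerSeries.coeff i (traceSeries h) ∈ C := by
    intro i
    rw [traceSeries, PowerSeries.coeff_mk]
    exact C.mul_mem (C.pow_mem (C.neg_mem C.one_mem) _) (hmem i)
  have hSv : ∀ i, χ ⟨_, hS i⟩ = (-1) ^ i * χ ⟨_, hmem i⟩ := by
    intro i
    rw [← map_one χ, ← map_neg, ← map_pow, ← map_mul]
    congr 1
    apply Subtype.ext
    simp [traceSeries]
  obtain ⟨_, E, -, hE0, hE⟩ := exists_real_logDeriv C χ _ _ (detOneAdd_coeff_zero h) hS
    (derivative_detOneAdd h)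
  refine Polynomial.exists_even_of_logDeriv hE0 hE ?_ ?_ fun i => ?_
  · rw [PowerSeries.coeff_mk, hSv, h1, mul_zero]
  · rw [PowerSeries.coeff_mk, hSv, h2]; ring
  · rw [PowerSeries.coeff_mk, PowerSeries.coeff_mk, hSv, hSv, hval]; ring

theorem exists_four_dvd_of_trace_pow [IsDomain R] [UniqueFactorizationMonoid R] [CharZero R]
    (s t : Matrix ι ι R) (hs : sᵀ = -s) (ht : tᵀ = -t) (m : ℝ)
    (hmem : ∀ i, trace ((s * t) ^ (i + 1)) ∈ C) (h1 : χ ⟨_, hmem 0⟩ = 0)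
    (h2 : χ ⟨_, hmem 1⟩ = -m) (hval : ∀ i, χ ⟨_, hmem (i + 2)⟩ = - χ ⟨_, hmem i⟩) :
    ∃ k : ℕ, m = 4 * k := by
  obtain ⟨q, hq0, hq⟩ := exists_sq_eq_detOneAdd_mul s t hs ht
  set S : PowerSeries R := (2⁻¹ : ℝ) • traceSeries (s * t) with hSdef
  have hS2 : traceSeries (s * t) = 2 * S := by
    rw [hSdef, two_mul, ← add_smul]
    norm_num
  have hder : ((Polynomial.derivative q : Polynomial R) : PowerSeries R) =
      (q : PowerSeries R) * S := by
    have h3 := derivative_detOneAdd (s * t)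
    rw [hq, hS2, Polynomial.derivative_sq] at h3
    have hqne : (q : PowerSeries R) ≠ 0 := by
      rw [Ne, Polynomial.coe_eq_zero_iff]
      rintro rfl
      simp at hq0
    have h2ne : (2 : PowerSeries R) ≠ 0 := by
      intro h0
      have h4 := congrArg (PowerSeries.coeff 0) h0
      rw [← map_ofNat PowerSeries.C 2, PowerSeries.coeff_zero_C, map_zero] at h4
      exact two_ne_zero h4
    apply mul_left_cancel₀ (mul_ne_zero h2ne hqne)
    push_cast at h3
    rw [map_ofNat] at h3
    linear_combination h3
  have hSc : ∀ i, PowerSeries.coeff i S = (2⁻¹ * (-1) ^ i : ℝ) • trace ((s * t) ^ (i + 1)) := by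
    intro i
    rw [hSdef, PowerSeries.coeff_smul, traceSeries, PowerSeries.coeff_mk, mul_smul]
    congr 1
    rw [Algebra.smul_def]
    simp
  have hS : ∀ i, PowerSeries.coeff i S ∈ C := by
    intro i
    rw [hSc]
    exact C.smul_mem (hmem i) _
  have hSv : ∀ i, χ ⟨_, hS i⟩ = 2⁻¹ * (-1) ^ i * χ ⟨_, hmem i⟩ := by
    intro i
    rw [← smul_eq_mul, ← map_smul]
    congr 1
    exact Subtype.ext (hSc i)
  obtain ⟨_, E, -, hE0, hE⟩ := exists_real_logDeriv C χ _ _ hq0 hS hder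
  obtain ⟨k, hk⟩ := Polynomial.exists_even_of_logDeriv (c := 2⁻¹ * m) hE0 hE
    (by rw [PowerSeries.coeff_mk, hSv, h1, mul_zero])
    (by rw [PowerSeries.coeff_mk, hSv, h2]; ring)
    (fun i => by rw [PowerSeries.coeff_mk, PowerSeries.coeff_mk, hSv, hSv, hval]; ring)
  exact ⟨k, by linarith⟩

/-- A Cayley-Hamilton relation with coefficients vanishing at a point where the traces of all
powers vanish. -/
theorem exists_pow_eq_sum_of_trace_pow_eq_zero [Nontrivial R] (h : Matrix ι ι R)
    (htr : ∀ i, ∃ hi : trace (h ^ (i + 1)) ∈ C, χ ⟨_, hi⟩ = 0) :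
    ∃ c : ℕ → C, (∀ k < Fintype.card ι, χ (c k) = 0) ∧
      h ^ Fintype.card ι + ∑ k ∈ Finset.range (Fintype.card ι), (c k : R) • h ^ k = 0 := by
  choose hmem hval using htr
  have hSc : ∀ i, PowerSeries.coeff i (traceSeries (-h)) = - trace (h ^ (i + 1)) := by
    intro i
    rw [traceSeries, PowerSeries.coeff_mk, show -h = (-1 : R) • h by simp, smul_pow, trace_smul,
      smul_eq_mul, ← mul_assoc, ← pow_add, show i + (i + 1) = 2 * i + 1 by ring, pow_succ, pow_mul]
    simp
  have hS : ∀ i, PowerSeries.coeff i (traceSeries (-h)) ∈ C := by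
    intro i
    rw [hSc]
    exact C.neg_mem (hmem i)
  obtain ⟨hC, E, hEc, hE0, hE⟩ := exists_real_logDeriv C χ _ _ (detOneAdd_coeff_zero (-h)) hS
    (derivative_detOneAdd (-h))
  have hT : (PowerSeries.mk fun i => χ ⟨PowerSeries.coeff i (traceSeries (-h)), hS i⟩) = 0 := by
    ext i
    rw [PowerSeries.coeff_mk, map_zero, ← neg_zero, ← hval i, ← map_neg]
    congr 1
    exact Subtype.ext (hSc i)
  have hE1 : ∀ k, E.coeff (k + 1) = 0 := by
    intro k
    have h3 := PowerSeries.coeff_succ_of_derivative_eq_mul hE k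
    rw [hT] at h3
    simp only [map_zero, mul_zero, Finset.sum_const_zero] at h3
    exact (mul_eq_zero.mp h3).resolve_left (by positivity)
  have hrev : detOneAdd (-h) = h.charpoly.reverse := by
    rw [reverse_charpoly, charpolyRev, detOneAdd, sub_eq_add_neg, ← smul_neg]
    congr 3
    ext1 i j
    simp
  have hcoef : ∀ k ≤ Fintype.card ι,
      h.charpoly.coeff k = (detOneAdd (-h)).coeff (Fintype.card ι - k) := by
    intro k hk
    rw [hrev, Polynomial.coeff_reverse, charpoly_natDegree_eq_dim,
      Polynomial.revAt_le (Nat.sub_le _ _), Nat.sub_sub_self hk]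
  refine ⟨fun k => ⟨_, hC (Fintype.card ι - k)⟩, fun k hk => ?_, ?_⟩
  · obtain ⟨j, hj⟩ : ∃ j, Fintype.card ι - k = j + 1 := ⟨_, (Nat.succ_pred_eq_of_pos (by omega)).symm⟩
    rw [← hEc, hj, hE1]
  · have h4 := aeval_self_charpoly h
    rw [Polynomial.aeval_eq_sum_range, charpoly_natDegree_eq_dim, Finset.sum_range_succ,
      hcoef _ le_rfl, Nat.sub_self, detOneAdd_coeff_zero, one_smul, add_comm] at h4
    rw [← h4]
    congr 1
    refine Finset.sum_congr rfl fun k hk => ?_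
    rw [hcoef k (Finset.mem_range.mp hk).le]

end TraceIdentities

theorem nonneg_of_forall_pos_mul_add_nonneg {x y : ℝ} (h : ∀ δ > 0, 0 ≤ x + δ * y) : 0 ≤ x := by
  by_contra! hx
  have h1 := h (-x / (2 * (|y| + 1))) (by have := abs_nonneg y; apply div_pos <;> linarith)
  have h2 : -x / (2 * (|y| + 1)) * y ≤ -x / 2 := by
    rw [div_mul_eq_mul_div, div_le_div_iff₀ (by positivity) two_pos]
    nlinarith [le_abs_self y, abs_nonneg y]
  linarith

theorem Submodule.sumSq_smul_mem {C V : Type*} [CommRing C] [AddCommGroup V] [Module C V]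
    (M : Submodule (Subsemiring.sumSq C) V) {s : C} (hs : IsSumSq s)
    {v : V} (hv : v ∈ M) : s • v ∈ M :=
  M.smul_mem ⟨s, Subsemiring.mem_sumSq.mpr hs⟩ hv

theorem Submodule.sumSq_sq_smul_mem {C V : Type*} [CommRing C] [AddCommGroup V] [Module C V]
    (M : Submodule (Subsemiring.sumSq C) V) (c : C)
    {v : V} (hv : v ∈ M) : (c ^ 2) • v ∈ M :=
  M.sumSq_smul_mem (sq c ▸ IsSumSq.mul_self c) hv

section QuadraticModule

variable {C V : Type*} [CommRing C] [Algebra ℝ C] [AddCommGroup V] [Module ℝ V] [Module C V]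
  [IsScalarTower ℝ C V]

theorem Submodule.sumSq_real_smul_mem (M : Submodule (Subsemiring.sumSq C) V) {r : ℝ} (hr : 0 ≤ r)
    {v : V} (hv : v ∈ M) : r • v ∈ M := by
  have h := M.sumSq_sq_smul_mem (algebraMap ℝ C (Real.sqrt r)) hv
  rwa [← map_pow, Real.sq_sqrt hr, algebraMap_smul] at h

/-- An archimedean quadratic module absorbs `a` as soon as it contains `s • a - u` for some sum of
squares `s`. -/
theorem Submodule.mem_of_sumSq_smul_sub_mem (M : Submodule (Subsemiring.sumSq C) V) {u : V}
    (hu : u ∈ M) (harch : ∀ v, ∃ N : ℝ, N • u - v ∈ M) {s : C} (hs : IsSumSq s) {a : V}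
    (h : s • a - u ∈ M) : a ∈ M := by
  have hmono : ∀ {x y : ℝ} {v : V}, x ≤ y → x • u + v ∈ M → y • u + v ∈ M := by
    intro x y v hxy hv
    have := M.add_mem (M.sumSq_real_smul_mem (sub_nonneg.mpr hxy) hu) hv
    rwa [sub_smul, ← add_assoc, sub_add_cancel] at this
  obtain ⟨N₁, h₁⟩ := harch ((s ^ 2) • a)
  obtain ⟨N₂, h₂⟩ := harch (s • u)
  obtain ⟨N, h₀⟩ := harch (-a)
  set k : ℝ := max 1 (max ((N₁ + 1) / 2) (N₂ / 2)) with hk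
  have hk1 : 1 ≤ k := le_max_left _ _
  have hk2 : N₁ ≤ 2 * k - 1 := by
    have : (N₁ + 1) / 2 ≤ k := (le_max_left _ _).trans (le_max_right _ _)
    linarith
  have hk3 : N₂ ≤ 2 * k := by
    have : N₂ / 2 ≤ k := (le_max_right _ _).trans (le_max_right _ _)
    linarith
  have hkpos : 0 < k := by linarith
  rw [sub_eq_add_neg] at h₁ h₂
  have e₁ := hmono hk2 h₁
  have e₂ := hmono hk3 h₂
  have step : ∀ r : ℝ, 0 ≤ r → r • u + a ∈ M → (r - (k ^ 2)⁻¹) • u + a ∈ M := by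
    intro r hr hra
    have t1 := M.sumSq_sq_smul_mem (algebraMap ℝ C k - s) hra
    have t2 := M.sumSq_real_smul_mem (by positivity : 0 ≤ 2 * k) h
    have t3 := M.sumSq_real_smul_mem hr (M.sumSq_smul_mem hs e₂)
    have t := M.sumSq_real_smul_mem (by positivity : 0 ≤ (k ^ 2)⁻¹)
      (M.add_mem (M.add_mem (M.add_mem t1 t2) t3) e₁)
    convert t using 1
    have hcoe : ∀ (x : ℝ) (v : V), x • v = (algebraMap ℝ C x) • v :=
      fun x v => (algebraMap_smul C x v).symm
    have hinv : algebraMap ℝ C (k ^ 2)⁻¹ * (algebraMap ℝ C k) ^ 2 = 1 := by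
      rw [← map_pow, ← map_mul, inv_mul_cancel₀ (by positivity), map_one]
    simp only [hcoe, map_sub, map_mul, map_ofNat, map_one]
    match_scalars
    · linear_combination (- algebraMap ℝ C r) * hinv
    · linear_combination (-1) * hinv
  have iter : ∀ j : ℕ, a ∈ M ∨ (N - j * (k ^ 2)⁻¹) • u + a ∈ M := by
    intro j
    induction j with
    | zero => right; simpa using h₀
    | succ j ih =>
      rcases ih with ih | ih
      · exact Or.inl ih
      · rcases le_or_gt 0 (N - j * (k ^ 2)⁻¹) with hr | hr
        · right
          convert step _ hr ih using 3
          push_cast; ring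
        · left
          simpa using hmono hr.le ih
  obtain ⟨j, hj⟩ := exists_nat_gt (N * k ^ 2)
  rcases iter j with h' | h'
  · exact h'
  · have : N - j * (k ^ 2)⁻¹ ≤ 0 := by
      rw [sub_nonpos, ← div_eq_mul_inv, le_div_iff₀ (by positivity)]
      exact hj.le
    simpa using hmono this h'

theorem Submodule.exists_total_of_notMem (M : Submodule (Subsemiring.sumSq C) V) {u : V}
    (hu : u ∈ M) (harch : ∀ v, ∃ N : ℝ, N • u - v ∈ M) {a : V} (ha : a ∉ M) :
    ∃ P : Submodule (Subsemiring.sumSq C) V, M ≤ P ∧ -a ∈ P ∧ -u ∉ P ∧ ∀ b, b ∈ P ∨ -b ∈ P := by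
  set P₀ := M ⊔ Submodule.span (Subsemiring.sumSq C) {-a} with hP₀
  have h0 : -u ∉ P₀ := by
    intro hmem
    obtain ⟨q, hq, y, hy, hqy⟩ := Submodule.mem_sup.mp hmem
    obtain ⟨s, rfl⟩ := Submodule.mem_span_singleton.mp hy
    refine ha (M.mem_of_sumSq_smul_sub_mem hu harch (Subsemiring.mem_sumSq.mp s.2) (a := a) ?_)
    have : (s : C) • a - u = q := by
      rw [Subsemiring.smul_def, smul_neg] at hqy
      rw [sub_eq_add_neg, ← hqy]; abel
    rwa [this]
  obtain ⟨P, hP₀P, hmax⟩ := zorn_le_nonempty₀ {P : Submodule (Subsemiring.sumSq C) V | -u ∉ P}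
    (fun c hc hchain y hy => by
      refine ⟨sSup c, ?_, fun z hz => le_sSup hz⟩
      intro hmem
      rw [Submodule.mem_sSup_of_directed ⟨y, hy⟩ hchain.directedOn] at hmem
      obtain ⟨z, hz, hz'⟩ := hmem
      exact hc hz hz') P₀ h0
  have huP : -u ∉ P := hmax.prop
  have hMP : M ≤ P := le_sup_left.trans hP₀P
  have key : ∀ b, b ∉ P → ∃ s : C, IsSumSq s ∧ ∃ p ∈ P, -u = p + s • b := by
    intro b hb
    have : -u ∈ P ⊔ Submodule.span (Subsemiring.sumSq C) {b} := by
      by_contra hcon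
      exact hb (hmax.le_of_ge hcon le_sup_left
        (Submodule.mem_sup_right (Submodule.mem_span_singleton_self b)))
    obtain ⟨q, hq, y, hy, hqy⟩ := Submodule.mem_sup.mp this
    obtain ⟨s, rfl⟩ := Submodule.mem_span_singleton.mp hy
    exact ⟨s, Subsemiring.mem_sumSq.mp s.2, q, hq, hqy.symm⟩
  refine ⟨P, hMP, hP₀P (Submodule.mem_sup_right (Submodule.mem_span_singleton_self _)), huP, ?_⟩
  intro b
  by_contra! hb
  obtain ⟨s, hs, p, hp, e⟩ := key b hb.1
  obtain ⟨s', hs', p', hp', e'⟩ := key (-b) hb.2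
  have hsu : -(s • u) ∈ P := by
    have h1 := P.add_mem (P.add_mem (P.sumSq_smul_mem hs' hp) (P.sumSq_smul_mem hs hp'))
      (P.sumSq_smul_mem hs' (hMP hu))
    convert h1 using 1
    have e2 : p = -u - s • b := by rw [e]; abel
    have e3 : p' = -u - s' • (-b) := by rw [e']; abel
    rw [e2, e3]
    module
  obtain ⟨N, hN⟩ := harch (-b)
  have hN' : |N| • u + b ∈ P := by
    have := P.add_mem (P.sumSq_real_smul_mem (sub_nonneg.mpr (le_abs_self N)) (hMP hu)) (hMP hN)
    convert this using 1
    module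
  have hsb : s • b ∈ P := by
    have := P.add_mem (P.sumSq_smul_mem hs hN') (P.sumSq_real_smul_mem (abs_nonneg N) hsu)
    convert this using 1
    rw [smul_add, smul_neg, ← algebraMap_smul C |N| u, ← algebraMap_smul C |N| (s • u)]
    module
  exact huP (e ▸ P.add_mem hp hsb)

/-- Every element outside an archimedean quadratic module is separated from it by a functional
which is multiplicative along the base ring. -/
theorem Submodule.exists_pure_state (M : Submodule (Subsemiring.sumSq C) V) {u : V}
    (hu : u ∈ M) (harch : ∀ v, ∃ N : ℝ, N • u - v ∈ M) {a : V} (ha : a ∉ M) :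
    ∃ (φ : V →ₗ[ℝ] ℝ) (χ : C →ₐ[ℝ] ℝ), (∀ c v, φ (c • v) = χ c * φ v) ∧ φ u = 1 ∧
      (∀ q ∈ M, 0 ≤ φ q) ∧ φ a ≤ 0 := by
  obtain ⟨P, hMP, haP, huP, htot⟩ := M.exists_total_of_notMem hu harch ha
  have hu0 : u ≠ 0 := by
    rintro rfl
    exact huP (by simp)
  let cone : PointedCone ℝ V :=
    { carrier := P
      add_mem' := fun h h' => P.add_mem h h'
      zero_mem' := P.zero_mem
      smul_mem' := fun r v hv => P.sumSq_real_smul_mem r.2 hv }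
  obtain ⟨φ, hφ, hpos⟩ := riesz_extension cone (LinearPMap.mkSpanSingleton u (1 : ℝ) hu0)
    (by
      rintro ⟨x, hx⟩ hxP
      obtain ⟨r, rfl⟩ := Submodule.mem_span_singleton.mp hx
      have e : LinearPMap.mkSpanSingleton u (1 : ℝ) hu0 ⟨r • u, hx⟩ = r • (1 : ℝ) :=
        LinearPMap.mkSpanSingleton'_apply _ _ _ _ _
      rw [e]
      by_contra! hr
      have hr' : r < 0 := by simpa using hr
      have := P.sumSq_real_smul_mem (r := (-r)⁻¹) (by rw [inv_nonneg]; linarith) hxP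
      rw [smul_smul, inv_neg, neg_mul, inv_mul_cancel₀ hr'.ne, neg_one_smul] at this
      exact huP this)
    (fun y => by
      obtain ⟨N, hN⟩ := harch (-y)
      refine ⟨⟨N • u, Submodule.smul_mem _ _ (Submodule.mem_span_singleton_self u)⟩, ?_⟩
      rw [sub_neg_eq_add] at hN
      exact hMP hN)
  have hφu : φ u = 1 := by
    have := hφ ⟨u, Submodule.mem_span_singleton_self u⟩
    rw [this]
    exact LinearPMap.mkSpanSingleton_apply ℝ _ hu0 (1 : ℝ)
  have hφP : ∀ v ∈ P, 0 ≤ φ v := hpos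
  have hPφ : ∀ v, 0 < φ v → v ∈ P := by
    intro v hv
    rcases htot v with h | h
    · exact h
    · have := hφP _ h
      rw [map_neg] at this
      linarith
  have hcoe : ∀ (r : ℝ) (v : V), (algebraMap ℝ C r) • v = r • v := fun r v => algebraMap_smul C r v
  have hker : ∀ c : C, φ (c • u) = 0 → ∀ v, φ (c • v) = 0 := by
    intro c hc
    have hc2 : φ ((c ^ 2) • u) = 0 := by
      have hge := hφP _ (P.sumSq_sq_smul_mem c (hMP hu))
      refine le_antisymm ?_ hge
      rw [← neg_nonneg]
      refine nonneg_of_forall_pos_mul_add_nonneg (y := 1 + φ ((c ^ 2) • u)) fun ε hε => ?_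
      have h1 := P.sumSq_sq_smul_mem (1 + c) (hPφ ((2 * ε) • u - c • u) (by
        rw [map_sub, map_smul, hφu, hc, smul_eq_mul]; linarith))
      have h2 := P.sumSq_sq_smul_mem (1 - c) (hPφ ((2 * ε) • u + c • u) (by
        rw [map_add, map_smul, hφu, hc, smul_eq_mul]; linarith))
      have h3 := hφP _ (P.add_mem h1 h2)
      have h4 : (1 + c) ^ 2 • ((2 * ε) • u - c • u) + (1 - c) ^ 2 • ((2 * ε) • u + c • u) =
          (4 * ε) • u + (4 * ε) • (c ^ 2 • u) - (4 : ℝ) • (c ^ 2 • u) := by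
        simp only [← hcoe, map_mul, map_ofNat]
        module
      rw [h4] at h3
      simp only [map_sub, map_add, map_smul, hφu, smul_eq_mul] at h3
      linarith
    have habs : ∀ v, ∃ N : ℝ, 0 ≤ N ∧ N • u - v ∈ P ∧ N • u + v ∈ P := by
      intro v
      obtain ⟨N₁, h₁⟩ := harch v
      obtain ⟨N₂, h₂⟩ := harch (-v)
      refine ⟨max |N₁| |N₂|, (abs_nonneg _).trans (le_max_left _ _), ?_, ?_⟩
      · have := P.add_mem (P.sumSq_real_smul_mem (sub_nonneg.mpr
          ((le_abs_self N₁).trans (le_max_left _ |N₂|))) (hMP hu)) (hMP h₁)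
        convert this using 1
        module
      · have := P.add_mem (P.sumSq_real_smul_mem (sub_nonneg.mpr
          ((le_abs_self N₂).trans (le_max_right |N₁| _))) (hMP hu)) (hMP h₂)
        convert this using 1
        module
    have hc2v : ∀ v, φ ((c ^ 2) • v) = 0 := by
      intro v
      obtain ⟨N, -, h₁, h₂⟩ := habs v
      have e₁ := hφP _ (P.sumSq_sq_smul_mem c h₁)
      have e₂ := hφP _ (P.sumSq_sq_smul_mem c h₂)
      rw [smul_sub, smul_comm, map_sub, map_smul, hc2, smul_zero] at e₁
      rw [smul_add, smul_comm, map_add, map_smul, hc2, smul_zero] at e₂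
      linarith
    have hge : ∀ v, 0 ≤ φ (c • v) := by
      intro v
      obtain ⟨N, -, -, h₂⟩ := habs v
      refine nonneg_of_forall_pos_mul_add_nonneg (y := (N + φ v) / 2) fun δ hδ => ?_
      have e := hφP _ (P.sumSq_sq_smul_mem (c + algebraMap ℝ C δ) h₂)
      have h4 : (c + algebraMap ℝ C δ) ^ 2 • (N • u + v) = N • (c ^ 2 • u) + (2 * δ * N) • c • u +
          (δ ^ 2 * N) • u + c ^ 2 • v + (2 * δ) • c • v + (δ ^ 2) • v := by
        simp only [← hcoe, map_mul, map_ofNat, map_pow]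
        module
      rw [h4] at e
      simp only [map_add, map_smul, hc2, hc, hφu, hc2v, smul_eq_mul] at e
      have : 0 ≤ (2 * δ) * (φ (c • v) + δ * ((N + φ v) / 2)) := by linarith
      exact nonneg_of_mul_nonneg_right this (by linarith)
    intro v
    refine le_antisymm ?_ (hge v)
    have := hge (-v)
    rw [smul_neg, map_neg] at this
    linarith
  have hmul : ∀ (c : C) (v : V), φ (c • v) = φ (c • u) * φ v := by
    intro c v
    have h1 := hker (c - algebraMap ℝ C (φ (c • u)))
      (by rw [sub_smul, hcoe, map_sub, map_smul φ (φ (c • u)), hφu, smul_eq_mul, mul_one, sub_self]) v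
    rw [sub_smul, hcoe, map_sub, map_smul φ (φ (c • u)), smul_eq_mul] at h1
    linarith
  let χ : C →ₐ[ℝ] ℝ := AlgHom.ofLinearMap
    { toFun := fun c => φ (c • u)
      map_add' := fun c d => by rw [add_smul, map_add]
      map_smul' := fun r c => by rw [smul_assoc, map_smul]; rfl }
    (by simp [hφu])
    (fun c d => by
      change φ ((c * d) • u) = φ (c • u) * φ (d • u)
      rw [mul_smul, hmul])
  refine ⟨φ, χ, fun c v => hmul c v, hφu, fun q hq => hφP q (hMP hq), ?_⟩
  have := hφP _ haP
  rw [map_neg] at this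
  linarith

end QuadraticModule

/-- A faithful, positive, involution-invariant tracial functional on a real algebra with
involution. -/
structure IsFaithfulTrace {B : Type*} [Ring B] [StarRing B] [Algebra ℝ B] (τ : B →ₗ[ℝ] ℝ) :
    Prop where
  map_mul_comm : ∀ a b, τ (a * b) = τ (b * a)
  map_star : ∀ a, τ (star a) = τ a
  pos : ∀ a, a ≠ 0 → 0 < τ (a * star a)

/-- A nonzero self-adjoint idempotent whose corner has only scalar self-adjoint elements. -/
structure IsMinimalProjection {B : Type*} [Ring B] [StarRing B] [Algebra ℝ B] (p : B) :
    Prop where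
  isStarProjection : IsStarProjection p
  ne_zero : p ≠ 0
  eq_smul : ∀ x, star x = x → p * x * p = x → ∃ r : ℝ, x = r • p

namespace IsFaithfulTrace

variable {B : Type*} [Ring B] [StarRing B] [Algebra ℝ B] [StarModule ℝ B] {τ : B →ₗ[ℝ] ℝ}

/-- The inner product attached to a faithful trace. -/
abbrev innerCore (hτ : IsFaithfulTrace τ) : InnerProductSpace.Core ℝ B where
  inner a b := τ (b * star a)
  conj_inner_symm a b := by
    rw [starRingEnd_apply, star_trivial, ← hτ.map_star, star_mul, star_star]
  re_inner_nonneg a := by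
    by_cases h : a = 0
    · simp [h]
    · exact (hτ.pos a h).le
  add_left a b c := by rw [star_add, mul_add, map_add]
  smul_left a b r := by
    rw [star_smul, mul_smul_comm, map_smul, starRingEnd_apply, smul_eq_mul, star_trivial r]
  definite a h := by
    by_contra h0
    exact (hτ.pos a h0).ne' h

/-- The norm attached to a faithful trace. -/
abbrev normedAddCommGroup (hτ : IsFaithfulTrace τ) : NormedAddCommGroup B :=
  hτ.innerCore.toNormedAddCommGroup

/-- The inner product space structure attached to a faithful trace. -/
abbrev innerProductSpace (hτ : IsFaithfulTrace τ) :
    @InnerProductSpace ℝ B _ hτ.normedAddCommGroup.toSeminormedAddCommGroup :=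
  @InnerProductSpace.ofCore ℝ B _ _ _ hτ.innerCore.toCore

theorem eq_zero_of_forall {B : Type*} [Ring B] [StarRing B] [Algebra ℝ B] {τ : B →ₗ[ℝ] ℝ}
    (hτ : IsFaithfulTrace τ) {a : B} (h : ∀ b, τ (a * b) = 0) : a = 0 := by
  by_contra h0
  exact (hτ.pos a h0).ne' (h _)

variable [FiniteDimensional ℝ B]

/-- Every right ideal is generated by a projection. -/
theorem exists_projection (hτ : IsFaithfulTrace τ) (I : Submodule ℝ B)
    (hI : ∀ y ∈ I, ∀ b, y * b ∈ I) : ∃ p ∈ I, IsStarProjection p ∧ ∀ y ∈ I, p * y = y := by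
  let := hτ.normedAddCommGroup
  let := hτ.innerProductSpace
  have hinner : ∀ a b : B, inner ℝ a b = τ (b * star a) := fun _ _ => rfl
  obtain ⟨p, hp, p', hp', hsum⟩ := I.exists_add_mem_mem_orthogonal (1 : B)
  have hperp : ∀ y ∈ I, τ (p' * star y) = 0 := fun y hy => hp' y hy
  have hpy : ∀ y ∈ I, p * y = y := by
    intro y hy
    have h1 : p' * y ∈ I := by
      have : p' * y = y - p * y := by
        rw [eq_sub_iff_add_eq, ← add_mul, add_comm p', ← hsum, one_mul]
      rw [this]
      exact I.sub_mem hy (hI _ hp _)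
    have h2 : p' * y = 0 := by
      by_contra h0
      refine (hτ.pos _ h0).ne' ?_
      rw [mul_assoc, ← star_star (y * star (p' * y)), star_mul, star_star]
      exact hperp _ (hI _ h1 _)
    rw [← add_zero (p * y), ← h2, ← add_mul, ← hsum, one_mul]
  have h3 : star p * p' = 0 := by
    refine hτ.eq_zero_of_forall fun b => ?_
    rw [mul_assoc, hτ.map_mul_comm, mul_assoc, ← star_star b, ← star_mul]
    exact hperp _ (hI _ hp _)
  have h4 : star p = star p * p := by
    have : p' = 1 - p := by rw [hsum]; abel
    rw [this, mul_sub, mul_one, sub_eq_zero] at h3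
    exact h3
  have h5 : star p = p := by
    rw [← star_star (star p), h4, star_mul, star_star, ← h4, star_star]
  exact ⟨p, hp, ⟨hpy p hp, h5⟩, hpy⟩

/-- Every nonzero right ideal contains a minimal projection. -/
theorem exists_minimalProjection (hτ : IsFaithfulTrace τ) (I : Submodule ℝ B)
    (hI : ∀ y ∈ I, ∀ b, y * b ∈ I) (hne : I ≠ ⊥) : ∃ p ∈ I, IsMinimalProjection p := by
  induction hd : Module.finrank ℝ I using Nat.strong_induction_on generalizing I with
  | _ d ih =>
  obtain ⟨p, hpI, hp, hpy⟩ := hτ.exists_projection I hI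
  have hp0 : p ≠ 0 := by
    rintro rfl
    refine hne ((Submodule.eq_bot_iff I).mpr fun y hy => ?_)
    rw [← hpy y hy, zero_mul]
  by_cases hmin : ∀ x, star x = x → p * x * p = x → ∃ r : ℝ, x = r • p
  · exact ⟨p, hpI, hp, hp0, hmin⟩
  push Not at hmin
  obtain ⟨x, hx, hpx, hxr⟩ := hmin
  have hpx' : p * x = x := by
    rw [← hpx, ← mul_assoc, ← mul_assoc, hp.isIdempotentElem.eq]
  have hxp : x * p = x := by
    rw [← hpx, mul_assoc, hp.isIdempotentElem.eq]
  have hxI : ∀ y ∈ I, LinearMap.mulLeft ℝ x y ∈ I := by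
    intro y _
    rw [LinearMap.mulLeft_apply, ← hpx', mul_assoc]
    exact hI p hpI _
  obtain ⟨μ, v, hvI, hv0, hv⟩ : ∃ μ : ℝ, ∃ v ∈ I, v ≠ 0 ∧ x * v = μ • v := by
    let := hτ.normedAddCommGroup
    let := hτ.innerProductSpace
    have hsym : (LinearMap.mulLeft ℝ x).IsSymmetric := by
      intro a b
      change τ (b * star (x * a)) = τ (x * b * star a)
      rw [star_mul, hx, ← mul_assoc, hτ.map_mul_comm, mul_assoc]
    have : Nontrivial I := Submodule.nontrivial_iff_ne_bot.mpr hne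
    have h1 := (hsym.restrict_invariant hxI).hasEigenvalue_iSup_of_finiteDimensional
    obtain ⟨μ, hμ⟩ : ∃ μ : ℝ, Module.End.HasEigenvalue
      ((LinearMap.mulLeft ℝ x).restrict hxI) μ := ⟨_, h1⟩
    obtain ⟨v, hv⟩ := hμ.exists_hasEigenvector
    refine ⟨μ, v, v.2, fun h0 => hv.2 (Subtype.ext h0), ?_⟩
    have := congrArg Subtype.val (Module.End.mem_eigenspace_iff.mp hv.1)
    exact this
  let K : Submodule ℝ B := I ⊓ LinearMap.ker (LinearMap.mulLeft ℝ x - μ • LinearMap.id)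
  have hK : ∀ y, y ∈ K ↔ y ∈ I ∧ x * y = μ • y := by
    intro y
    simp [K, sub_eq_zero]
  have hlt : K < I := by
    refine lt_of_le_of_ne inf_le_left fun h => ?_
    have := ((hK p).mp (h ▸ hpI)).2
    exact hxr μ (hxp ▸ this)
  obtain ⟨q, hq, hqmin⟩ := ih _ (hd ▸ Submodule.finrank_lt_finrank_of_lt hlt) K
    (fun y hy b => by
      rw [hK] at hy ⊢
      exact ⟨hI y hy.1 b, by rw [← mul_assoc, hy.2, smul_mul_assoc]⟩)
    (fun h => hv0 (by
      have : v ∈ K := (hK v).mpr ⟨hvI, hv⟩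
      rwa [h, Submodule.mem_bot] at this)) rfl
  exact ⟨q, hlt.le hq, hqmin⟩

/-- There are finitely many mutually disconnected minimal projections generating `B` as an
ideal. -/
theorem exists_finset_minimalProjection (hτ : IsFaithfulTrace τ) :
    ∃ F : Finset B, (∀ p ∈ F, IsMinimalProjection p) ∧
      (∀ p ∈ F, ∀ q ∈ F, p ≠ q → ∀ b, p * b * q = 0) ∧
      Submodule.span ℝ {z | ∃ p ∈ F, ∃ x y, z = x * p * y} = ⊤ := by
  classical
  by_contra! hcon
  have key : ∀ k : ℕ, ∃ F : Finset B, (∀ p ∈ F, IsMinimalProjection p) ∧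
      (∀ p ∈ F, ∀ q ∈ F, p ≠ q → ∀ b, p * b * q = 0) ∧ F.card = k := by
    intro k
    induction k with
    | zero => exact ⟨∅, by simp, by simp, rfl⟩
    | succ k ih =>
      obtain ⟨F, hF, hFF, hk⟩ := ih
      set J := Submodule.span ℝ {z | ∃ p ∈ F, ∃ x y, z = x * p * y} with hJ
      have hJr : ∀ y ∈ J, ∀ b, y * b ∈ J := by
        intro y hy b
        have : J ≤ J.comap (LinearMap.mulRight ℝ b) := by
          rw [hJ, Submodule.span_le]
          rintro _ ⟨p, hp, x, y, rfl⟩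
          exact Submodule.subset_span ⟨p, hp, x, y * b, by simp [mul_assoc]⟩
        exact this hy
      have hJl : ∀ p ∈ F, ∀ b, b * p ∈ J := fun p hp b =>
        Submodule.subset_span ⟨p, hp, b, 1, by rw [mul_one]⟩
      obtain ⟨z, hzJ, hz, hzy⟩ := hτ.exists_projection J hJr
      obtain ⟨q, hq, hqmin⟩ := hτ.exists_minimalProjection
        (LinearMap.range (LinearMap.mulLeft ℝ (1 - z)))
        (by
          rintro _ ⟨y, rfl⟩ b
          exact ⟨y * b, by simp [mul_assoc]⟩)
        (fun h => by
          have h1 : (1 - z) ∈ LinearMap.range (LinearMap.mulLeft ℝ (1 - z)) := ⟨1, by simp⟩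
          rw [h, Submodule.mem_bot, sub_eq_zero] at h1
          refine hcon F hF hFF ((Submodule.eq_top_iff').mpr fun b => ?_)
          have := hJr z hzJ b
          rwa [← h1, one_mul] at this)
      obtain ⟨c, hc⟩ := hq
      have hqJ : ∀ y ∈ J, q * y = 0 := by
        intro y hy
        rw [← hqmin.isStarProjection.isSelfAdjoint.star_eq, ← hc, LinearMap.mulLeft_apply,
          star_mul, star_sub, star_one, hz.isSelfAdjoint.star_eq, mul_assoc, sub_mul, one_mul,
          hzy y hy, sub_self, mul_zero]
      have hqF : ∀ p ∈ F, ∀ b, q * b * p = 0 := by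
        intro p hp b
        rw [mul_assoc]
        exact hqJ _ (hJl p hp b)
      have hFq : ∀ p ∈ F, ∀ b, p * b * q = 0 := by
        intro p hp b
        have := congrArg star (hqF p hp (star b))
        rwa [star_mul, star_mul, star_star, hqmin.isStarProjection.isSelfAdjoint.star_eq,
          (hF p hp).isStarProjection.isSelfAdjoint.star_eq, star_zero, ← mul_assoc] at this
      have hqnot : q ∉ F := by
        intro hmem
        apply hqmin.ne_zero
        have := hqF q hmem 1
        rwa [mul_one, hqmin.isStarProjection.isIdempotentElem.eq] at this
      refine ⟨insert q F, ?_, ?_, by rw [Finset.card_insert_of_notMem hqnot, hk]⟩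
      · intro p hp
        rcases Finset.mem_insert.mp hp with rfl | hp
        · exact hqmin
        · exact hF p hp
      · intro p hp p' hp' hne b
        rcases Finset.mem_insert.mp hp with h₁ | h₁ <;>
          rcases Finset.mem_insert.mp hp' with h₂ | h₂
        · exact absurd (h₁.trans h₂.symm) hne
        · exact h₁ ▸ hqF p' h₂ b
        · exact h₂ ▸ hFq p h₁ b
        · exact hFF p h₁ p' h₂ hne b
  obtain ⟨F, hF, hFF, hk⟩ := key (Module.finrank ℝ B + 1)
  have hli : LinearIndependent ℝ (fun p : F => (p : B)) := by
    rw [Fintype.linearIndependent_iff]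
    intro c hc p
    have h1 := congrArg ((p : B) * ·) hc
    simp only [Finset.mul_sum, mul_smul_comm, mul_zero] at h1
    rw [Finset.sum_eq_single p, (hF p p.2).isStarProjection.isIdempotentElem.eq] at h1
    · exact (smul_eq_zero.mp h1).resolve_right (hF p p.2).ne_zero
    · intro q _ hq
      have := hFF p p.2 q q.2 (fun h => hq (Subtype.ext h.symm)) 1
      rw [mul_one] at this
      rw [this, smul_zero]
    · simp
  have := hli.fintype_card_le_finrank
  rw [Fintype.card_coe, hk] at this
  omega

end IsFaithfulTrace

/-- The corner `p B p`. -/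
def corner {B : Type*} [Ring B] [Algebra ℝ B] (p : B) : Submodule ℝ B :=
  LinearMap.range ((LinearMap.mulLeft ℝ p).comp (LinearMap.mulRight ℝ p))

theorem mem_corner {B : Type*} [Ring B] [Algebra ℝ B] {p : B} (hp : IsIdempotentElem p) {x : B} :
    x ∈ corner p ↔ p * x = x ∧ x * p = x := by
  constructor
  · rintro ⟨y, rfl⟩
    simp only [LinearMap.comp_apply, LinearMap.mulLeft_apply, LinearMap.mulRight_apply]
    exact ⟨by rw [← mul_assoc, hp.eq], by rw [mul_assoc, mul_assoc, hp.eq]⟩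
  · rintro ⟨h1, h2⟩
    exact ⟨x, by simp [h1, h2]⟩

theorem finrank_corner_eq_card {B : Type*} [Ring B] [Algebra ℝ B] {p : B} {ι : Type*}
    [Fintype ι] {b : ι → B}
    (hb : LinearIndependent ℝ b) (hmem : ∀ i, b i ∈ corner p)
    (hspan : ∀ x ∈ corner p, x ∈ Submodule.span ℝ (Set.range b)) :
    Module.finrank ℝ (corner p) = Fintype.card ι := by
  have : corner p = Submodule.span ℝ (Set.range b) := by
    refine le_antisymm hspan (Submodule.span_le.mpr ?_)
    rintro _ ⟨i, rfl⟩
    exact hmem i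
  rw [this, finrank_span_eq_card hb]

namespace IsMinimalProjection

variable {B : Type*} [Ring B] [StarRing B] [Algebra ℝ B] [StarModule ℝ B] {p : B}

theorem exists_eq_smul_add_skew (hp : IsMinimalProjection p) {x : B} (hx : x ∈ corner p) :
    ∃ (r : ℝ) (y : B), y ∈ corner p ∧ star y = -y ∧ x = r • p + y := by
  have hpi := hp.isStarProjection.isIdempotentElem
  have hps := hp.isStarProjection.isSelfAdjoint.star_eq
  have hxs : star x ∈ corner p := by
    rw [mem_corner hpi] at hx ⊢
    constructor
    · conv_rhs => rw [← hx.2, star_mul, hps]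
    · conv_rhs => rw [← hx.1, star_mul, hps]
  have hsum : x + star x ∈ corner p := (corner p).add_mem hx hxs
  obtain ⟨r, hr⟩ := hp.eq_smul (x + star x) (by rw [star_add, star_star, add_comm]) (by
    rw [mem_corner hpi] at hsum
    rw [hsum.1, hsum.2])
  refine ⟨r / 2, (2⁻¹ : ℝ) • (x - star x), (corner p).smul_mem _ ((corner p).sub_mem hx hxs),
    ?_, ?_⟩
  · rw [star_smul, star_sub, star_star, star_trivial]
    module
  · rw [div_eq_inv_mul, mul_smul, ← hr]
    module

theorem exists_anticommutator {B : Type*} [Ring B] [StarRing B] [Algebra ℝ B] {p : B}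
    (hp : IsMinimalProjection p) {x y : B} (hx : x ∈ corner p)
    (hy : y ∈ corner p) (hxs : star x = -x) (hys : star y = -y) :
    ∃ r : ℝ, x * y + y * x = r • p := by
  have hpi := hp.isStarProjection.isIdempotentElem
  rw [mem_corner hpi] at hx hy
  refine hp.eq_smul _ ?_ ?_
  · rw [star_add, star_mul, star_mul, hxs, hys]
    noncomm_ring
  · rw [mul_add, add_mul, ← mul_assoc, ← mul_assoc, hx.1, hy.1, mul_assoc, mul_assoc, hx.2, hy.2]

theorem exists_smul_sq_eq_neg {B : Type*} [Ring B] [StarRing B] [Algebra ℝ B] {p : B}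
    (hp : IsMinimalProjection p) {τ : B →ₗ[ℝ] ℝ} (hτ : IsFaithfulTrace τ) {x : B} (hx : x ∈ corner p) (hxs : star x = -x) (hx0 : x ≠ 0) :
    ∃ c : ℝ, c ≠ 0 ∧ (c • x) * (c • x) = -p := by
  obtain ⟨r, hr⟩ := hp.exists_anticommutator hx hx hxs hxs
  have h1 := hτ.pos x hx0
  have h2 := hτ.pos p hp.ne_zero
  rw [hp.isStarProjection.isSelfAdjoint.star_eq, hp.isStarProjection.isIdempotentElem.eq] at h2
  rw [hxs, mul_neg, map_neg] at h1
  have h3 := congrArg τ hr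
  rw [map_add, map_smul, smul_eq_mul] at h3
  have hr0 : r < 0 := by
    by_contra! h
    nlinarith [mul_nonneg h h2.le]
  have hxx : x * x = (r / 2) • p := by
    rw [div_eq_inv_mul, mul_smul, ← hr]
    module
  refine ⟨Real.sqrt (-(r / 2))⁻¹, (Real.sqrt_pos.mpr (by rw [inv_pos]; linarith)).ne', ?_⟩
  rw [smul_mul_smul_comm, Real.mul_self_sqrt (by rw [inv_nonneg]; linarith), hxx, smul_smul,
    inv_neg, neg_mul, inv_mul_cancel₀ (by linarith), neg_one_smul]

/-- The trace of a minimal projection is an integral multiple of the dimension of its corner. -/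
theorem exists_trace_eq_mul_finrank (hp : IsMinimalProjection p) {τ : B →ₗ[ℝ] ℝ}
    (hτ : IsFaithfulTrace τ)
    (h₁ : ∃ k : ℕ, τ p = k)
    (h₂ : ∀ u, star u = -u → p * u = u → u * u = -p → ∃ k : ℕ, τ p = 2 * k)
    (h₄ : ∀ u v, star u = -u → star v = -v → p * u = u → p * v = v → u * u = -p → v * v = -p →
      u * v = -(v * u) → ∃ k : ℕ, τ p = 4 * k) :
    ∃ k : ℕ, τ p = k * Module.finrank ℝ (corner p) := by
  have hpi := hp.isStarProjection.isIdempotentElem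
  have hpp : p * p = p := hpi.eq
  have hps := hp.isStarProjection.isSelfAdjoint.star_eq
  have hpc : p ∈ corner p := (mem_corner hpi).mpr ⟨hpi.eq, hpi.eq⟩
  by_cases hu : ∀ u ∈ corner p, star u = -u → u = 0
  · have hfin := finrank_corner_eq_card (b := fun _ : Unit => p)
      (LinearIndependent.of_subsingleton () hp.ne_zero) (fun _ => hpc) (fun x hx => by
        obtain ⟨r, y, hy, hys, rfl⟩ := hp.exists_eq_smul_add_skew hx
        rw [hu y hy hys, add_zero, Set.range_const]
        exact Submodule.smul_mem _ _ (Submodule.mem_span_singleton_self p))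
    obtain ⟨k, hk⟩ := h₁
    exact ⟨k, by rw [hfin, hk]; simp⟩
  push Not at hu
  obtain ⟨u, huc, hus, hu0⟩ := hu
  obtain ⟨c, hc0, hc⟩ := hp.exists_smul_sq_eq_neg hτ huc hus hu0
  replace huc := (corner p).smul_mem c huc
  replace hus : star (c • u) = -(c • u) := by rw [star_smul, hus, smul_neg, star_trivial]
  generalize c • u = u at huc hus hc
  obtain ⟨hpu, hup⟩ := (mem_corner hpi).mp huc
  by_cases hv : ∀ v ∈ corner p, star v = -v → ∃ r : ℝ, v = r • u
  · have hli : LinearIndependent ℝ ![p, u] := by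
      rw [LinearIndependent.pair_iff]
      intro s t hst
      have h5 : (s • p + t • u) * (s • p - t • u) = (s ^ 2 + t ^ 2) • p := by
        simp only [mul_sub, add_mul, smul_mul_assoc, mul_smul_comm, hpp, hpu, hup, hc]
        module
      rw [hst, zero_mul] at h5
      have h6 := (smul_eq_zero.mp h5.symm).resolve_right hp.ne_zero
      constructor <;> nlinarith [sq_nonneg s, sq_nonneg t]
    have hfin := finrank_corner_eq_card hli
      (fun i => by fin_cases i <;> assumption) (fun x hx => by
        obtain ⟨r, y, hy, hys, rfl⟩ := hp.exists_eq_smul_add_skew hx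
        obtain ⟨s, rfl⟩ := hv y hy hys
        exact Submodule.add_mem _ (Submodule.smul_mem _ _ (Submodule.subset_span ⟨0, rfl⟩))
          (Submodule.smul_mem _ _ (Submodule.subset_span ⟨1, rfl⟩)))
    obtain ⟨k, hk⟩ := h₂ u hus hpu hc
    exact ⟨k, by rw [hfin, hk]; simp [mul_comm]⟩
  push Not at hv
  obtain ⟨v, hvc, hvs, hvr⟩ := hv
  have anti : ∀ w ∈ corner p, star w = -w → w * w = -p → ∀ x ∈ corner p, star x = -x →
      ∃ r : ℝ, w * (x + r • w) = -((x + r • w) * w) := by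
    intro w hw hws hww x hx hxs
    obtain ⟨r, hr⟩ := hp.exists_anticommutator hw hx hws hxs
    refine ⟨r / 2, ?_⟩
    rw [← sub_eq_zero, sub_neg_eq_add]
    calc w * (x + (r / 2) • w) + (x + (r / 2) • w) * w
        = (w * x + x * w) + r • (w * w) := by
          simp only [mul_add, add_mul, smul_mul_assoc, mul_smul_comm]
          module
      _ = 0 := by rw [hr, hww]; module
  obtain ⟨r, hr⟩ := anti u huc hus hc v hvc hvs
  have hv0 : v + r • u ≠ 0 := by
    intro h0
    exact hvr (-r) (by rw [neg_smul]; exact eq_neg_of_add_eq_zero_left h0)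
  replace hvc := (corner p).add_mem hvc ((corner p).smul_mem r huc)
  replace hvs : star (v + r • u) = -(v + r • u) := by
    rw [star_add, star_smul, hvs, hus, star_trivial]; module
  generalize v + r • u = v at hvc hvs hr hv0
  obtain ⟨d, hd0, hd⟩ := hp.exists_smul_sq_eq_neg hτ hvc hvs hv0
  replace hvc := (corner p).smul_mem d hvc
  replace hvs : star (d • v) = -(d • v) := by rw [star_smul, hvs, smul_neg, star_trivial]
  replace hr : u * (d • v) = -((d • v) * u) := by
    rw [mul_smul_comm, hr, smul_mul_assoc, smul_neg]
  generalize d • v = v at hvc hvs hr hd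
  obtain ⟨hpv, hvp⟩ := (mem_corner hpi).mp hvc
  obtain ⟨k, hk⟩ := h₄ u v hus hvs hpu hpv hc hd hr
  have hvu : v * u = -(u * v) := by rw [hr, neg_neg]
  set w := u * v with hw
  have hws : star w = -w := by
    rw [hw, star_mul, hus, hvs, neg_mul_neg, hvu]
  have hpw : p * w = w := by rw [hw, ← mul_assoc, hpu]
  have hwp : w * p = w := by rw [hw, mul_assoc, hvp]
  have hwc : w ∈ corner p := (mem_corner hpi).mpr ⟨hpw, hwp⟩
  have huw : u * w = -v := by rw [hw, ← mul_assoc, hc, neg_mul, hpv]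
  have hwv : w * v = -u := by rw [hw, mul_assoc, hd, mul_neg, hup]
  have hwu : w * u = v := by rw [hw, mul_assoc, hvu, mul_neg, huw, neg_neg]
  have hvw : v * w = u := by
    rw [hw, ← mul_assoc, hvu, neg_mul, hwv, neg_neg]
  have hww : w * w = -p := by
    conv_lhs => rw [hw, mul_assoc, hvw, hc]
  have hli : LinearIndependent ℝ ![p, u, v, w] := by
    rw [Fintype.linearIndependent_iff]
    intro g hg
    simp only [Fin.sum_univ_four, Matrix.cons_val] at hg
    have h5 : (g 0 • p + g 1 • u + g 2 • v + g 3 • w) * (g 0 • p - g 1 • u - g 2 • v - g 3 • w) =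
        (g 0 ^ 2 + g 1 ^ 2 + g 2 ^ 2 + g 3 ^ 2) • p := by
      simp only [mul_sub, add_mul, smul_mul_assoc, mul_smul_comm, hpp, hpu, hup, hc, hpv, hvp, hpw,
        hwp, hd, hww, hvu, ← hw, huw, hwu, hvw, hwv]
      module
    rw [hg, zero_mul] at h5
    have h6 := (smul_eq_zero.mp h5.symm).resolve_right hp.ne_zero
    intro i
    fin_cases i <;> simp only [Fin.zero_eta, Fin.mk_one, Fin.reduceFinMk] <;>
      nlinarith [sq_nonneg (g 0), sq_nonneg (g 1), sq_nonneg (g 2), sq_nonneg (g 3)]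
  have hfin := finrank_corner_eq_card hli
    (fun i => by fin_cases i <;> assumption) (fun x hx => by
      obtain ⟨r, y, hy, hys, rfl⟩ := hp.exists_eq_smul_add_skew hx
      obtain ⟨r₁, e₁⟩ := anti u huc hus hc y hy hys
      obtain ⟨r₂, e₂⟩ := anti v hvc hvs hd y hy hys
      obtain ⟨r₃, e₃⟩ := anti w hwc hws hww y hy hys
      set z := y + r₁ • u + r₂ • v + r₃ • w with hz
      have f₁ : u * z = -(z * u) := by
        rw [hz]
        calc u * (y + r₁ • u + r₂ • v + r₃ • w)
            = u * (y + r₁ • u) + (r₂ • w - r₃ • v) := by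
              simp only [mul_add, mul_smul_comm, ← hw, huw]; module
          _ = _ := by
              rw [e₁]; simp only [add_mul, smul_mul_assoc, hvu, hwu]; module
      have f₂ : v * z = -(z * v) := by
        rw [hz]
        calc v * (y + r₁ • u + r₂ • v + r₃ • w)
            = v * (y + r₂ • v) + (r₃ • u - r₁ • w) := by
              simp only [mul_add, mul_smul_comm, hvu, hvw]; module
          _ = _ := by
              rw [e₂]; simp only [add_mul, smul_mul_assoc, ← hw, hwv]; module
      have f₃ : w * z = -(z * w) := by
        rw [hz]
        calc w * (y + r₁ • u + r₂ • v + r₃ • w)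
            = w * (y + r₃ • w) + (r₁ • v - r₂ • u) := by
              simp only [mul_add, mul_smul_comm, hwu, hwv]; module
          _ = _ := by
              rw [e₃]; simp only [add_mul, smul_mul_assoc, huw, hvw]; module
      have f₄ : w * z = z * w := by
        rw [hw, mul_assoc, f₂, mul_neg, ← mul_assoc, f₁, neg_mul, neg_neg, mul_assoc]
      have f₅ : w * z = 0 := by
        have h7 : (2 : ℝ) • (w * z) = 0 := by
          rw [two_smul]
          nth_rewrite 1 [f₃]
          rw [f₄, neg_add_cancel]
        exact (smul_eq_zero.mp h7).resolve_left two_ne_zero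
      have hzc : z ∈ corner p :=
        (corner p).add_mem ((corner p).add_mem ((corner p).add_mem hy
          ((corner p).smul_mem _ huc)) ((corner p).smul_mem _ hvc)) ((corner p).smul_mem _ hwc)
      have hz0 : z = 0 := by
        have := congrArg (w * ·) f₅
        simp only [mul_zero] at this
        rwa [← mul_assoc, hww, neg_mul, ((mem_corner hpi).mp hzc).1, neg_eq_zero] at this
      have hy' : r • p + y = r • p + (-r₁) • u + (-r₂) • v + (-r₃) • w := by
        have : y = z - r₁ • u - r₂ • v - r₃ • w := by rw [hz]; abel
        rw [this, hz0]; module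
      rw [hy']
      exact Submodule.add_mem _ (Submodule.add_mem _ (Submodule.add_mem _
        (Submodule.smul_mem _ _ (Submodule.subset_span ⟨0, rfl⟩))
        (Submodule.smul_mem _ _ (Submodule.subset_span ⟨1, rfl⟩)))
        (Submodule.smul_mem _ _ (Submodule.subset_span ⟨2, rfl⟩)))
        (Submodule.smul_mem _ _ (Submodule.subset_span ⟨3, rfl⟩)))
  exact ⟨k, by rw [hfin, hk]; simp [mul_comm]⟩

end IsMinimalProjection

namespace IsFaithfulTrace

variable {B : Type*} [Ring B] [StarRing B] [Algebra ℝ B] [StarModule ℝ B] {τ : B →ₗ[ℝ] ℝ}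
  [FiniteDimensional ℝ B]

/-- The representation of `B` on the left ideal generated by a projection. -/
theorem exists_leftIdeal_representation (hτ : IsFaithfulTrace τ) {p : B} (hp : IsStarProjection p) :
    ∃ (N : ℕ) (σ : B →ₐ[ℝ] Matrix (Fin N) (Fin N) ℝ), (∀ x, σ (star x) = (σ x).transpose) ∧
      (σ p).trace = Module.finrank ℝ (corner p) ∧ ∀ q, (∀ b, q * b * p = 0) → σ q = 0 := by
  let := hτ.normedAddCommGroup
  let := hτ.innerProductSpace
  set E : Submodule ℝ B := LinearMap.range (LinearMap.mulRight ℝ p) with hE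
  have hEp : ∀ y : E, (y : B) * p = y := by
    rintro ⟨_, y, rfl⟩
    simp [mul_assoc, hp.isIdempotentElem.eq]
  have hmem : ∀ (x : B), ∀ y ∈ E, LinearMap.mulLeft ℝ x y ∈ E := by
    rintro x _ ⟨y, rfl⟩
    exact ⟨x * y, by simp [mul_assoc]⟩
  let lam : B →ₐ[ℝ] Module.End ℝ E := AlgHom.ofLinearMap
    { toFun := fun x => (LinearMap.mulLeft ℝ x).restrict (hmem x)
      map_add' := fun x y => by ext; simp [add_mul]
      map_smul' := fun r x => by ext; simp }
    (by ext; simp)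
    (fun x y => by ext; simp)
  have hlam : ∀ x (y : E), ((lam x y : E) : B) = x * y := fun _ _ => rfl
  let b := stdOrthonormalBasis ℝ E
  let σ : B →ₐ[ℝ] Matrix (Fin (Module.finrank ℝ E)) (Fin (Module.finrank ℝ E)) ℝ :=
    (LinearMap.toMatrixAlgEquiv b.toBasis).toAlgHom.comp lam
  have hσ : ∀ x, σ x = LinearMap.toMatrix b.toBasis b.toBasis (lam x) := fun _ => rfl
  refine ⟨_, σ, ?_, ?_, ?_⟩
  · intro x
    have h1 : lam (star x) = LinearMap.adjoint (lam x) := by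
      rw [LinearMap.eq_adjoint_iff]
      intro y z
      change τ ((z : B) * star (star x * (y : B))) = τ (x * (z : B) * star (y : B))
      rw [star_mul, star_star, ← mul_assoc, hτ.map_mul_comm, mul_assoc]
    rw [hσ, hσ, h1, LinearMap.toMatrix_adjoint, Matrix.conjTranspose_eq_transpose_of_trivial]
  · have hle : corner p ≤ E := fun x hx => ⟨x, ((mem_corner hp.isIdempotentElem).mp hx).2⟩
    have hproj : LinearMap.IsProj ((corner p).comap E.subtype) (lam p) := by
      constructor
      · intro y
        rw [Submodule.mem_comap, mem_corner hp.isIdempotentElem]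
        exact ⟨by rw [Submodule.subtype_apply, hlam, ← mul_assoc, hp.isIdempotentElem.eq], hEp _⟩
      · intro y hy
        rw [Submodule.mem_comap, mem_corner hp.isIdempotentElem] at hy
        exact Subtype.ext hy.1
    rw [hσ, ← LinearMap.trace_eq_matrix_trace, hproj.trace,
      (Submodule.comapSubtypeEquivOfLe hle).finrank_eq]
  · intro q hq
    have : lam q = 0 := by
      ext y
      rw [hlam, ← hEp y, ← mul_assoc, hq]
      rfl
    rw [hσ, this, map_zero]

/-- A finite-dimensional real algebra with involution and an integral faithful trace `τ` is a
subalgebra of the real matrices of size `τ 1`, with `τ` the restriction of the matrix trace. -/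
theorem exists_representation (hτ : IsFaithfulTrace τ) {n : ℕ} (hn : τ 1 = n)
    (h₁ : ∀ p, IsStarProjection p → ∃ k : ℕ, τ p = k)
    (h₂ : ∀ p u, IsStarProjection p → star u = -u → p * u = u → u * u = -p →
      ∃ k : ℕ, τ p = 2 * k)
    (h₄ : ∀ p u v, IsStarProjection p → star u = -u → star v = -v → p * u = u → p * v = v →
      u * u = -p → v * v = -p → u * v = -(v * u) → ∃ k : ℕ, τ p = 4 * k) :
    ∃ ρ : B →ₐ[ℝ] Matrix (Fin n) (Fin n) ℝ, (∀ x, ρ (star x) = (ρ x).transpose) ∧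
      ∀ x, (ρ x).trace = τ x := by
  classical
  obtain ⟨F, hF, hFF, hspan⟩ := hτ.exists_finset_minimalProjection
  have hk : ∀ p : F, ∃ k : ℕ, τ p = k * Module.finrank ℝ (corner (p : B)) := fun p =>
    (hF p p.2).exists_trace_eq_mul_finrank hτ (h₁ _ (hF p p.2).isStarProjection)
      (fun u => h₂ p u (hF p p.2).isStarProjection)
      (fun u v => h₄ p u v (hF p p.2).isStarProjection)
  choose k hk using hk
  choose N σ hσs hσp hσq using fun p : F =>
    hτ.exists_leftIdeal_representation (hF p p.2).isStarProjection
  let ι := Σ i : (Σ p : F, Fin (k p)), Fin (N i.1)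
  let ρ₀ : B →ₐ[ℝ] Matrix ι ι ℝ := AlgHom.ofLinearMap
    { toFun := fun x => Matrix.blockDiagonal' fun i : (Σ p : F, Fin (k p)) => σ i.1 x
      map_add' := fun x y => by
        rw [← Matrix.blockDiagonal'_add]
        congr 1
        ext i : 1
        rw [map_add]; rfl
      map_smul' := fun r x => by
        rw [RingHom.id_apply, ← Matrix.blockDiagonal'_smul]
        congr 1
        ext i : 1
        rw [map_smul]; rfl }
    (by
      change (Matrix.blockDiagonal' fun i : (Σ p : F, Fin (k p)) => σ i.1 1) = 1
      rw [← Matrix.blockDiagonal'_one]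
      congr 1
      ext i : 1
      rw [map_one]; rfl)
    (fun x y => by
      change (Matrix.blockDiagonal' fun i : (Σ p : F, Fin (k p)) => σ i.1 (x * y)) =
        (Matrix.blockDiagonal' fun i : (Σ p : F, Fin (k p)) => σ i.1 x) *
          Matrix.blockDiagonal' fun i : (Σ p : F, Fin (k p)) => σ i.1 y
      rw [← Matrix.blockDiagonal'_mul]
      congr 1
      ext i : 1
      rw [map_mul])
  have hρ₀ : ∀ x, ρ₀ x = Matrix.blockDiagonal' fun i : (Σ p : F, Fin (k p)) => σ i.1 x :=
    fun _ => rfl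
  have hstar : ∀ x, ρ₀ (star x) = (ρ₀ x).transpose := by
    intro x
    rw [hρ₀, hρ₀, Matrix.blockDiagonal'_transpose]
    congr 1
    ext i : 1
    exact hσs _ x
  have htr₀ : ∀ x, (ρ₀ x).trace = ∑ p : F, (k p : ℝ) * (σ p x).trace := by
    intro x
    rw [hρ₀, Matrix.trace_blockDiagonal', Fintype.sum_sigma]
    refine Finset.sum_congr rfl fun p _ => ?_
    change ∑ _ : Fin (k p), (σ p x).trace = _
    rw [Finset.sum_const, Finset.card_univ, Fintype.card_fin, nsmul_eq_mul]
  have hcyc : ∀ (p : F) (q : F) x y, (σ p (x * q * y)).trace = (σ p (q * (y * x) * q)).trace := by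
    intro p q x y
    have hq := (hF q q.2).isStarProjection.isIdempotentElem.eq
    rw [show x * (q : B) * y = (x * q) * (q * y) by
        rw [mul_assoc x (q : B) (q * y), ← mul_assoc (q : B) (q : B), hq, mul_assoc],
      map_mul, Matrix.trace_mul_comm, ← map_mul]
    simp only [mul_assoc]
  have htr : ∀ x, (ρ₀ x).trace = τ x := by
    have : (Matrix.traceLinearMap ι ℝ ℝ).comp ρ₀.toLinearMap = τ := by
      refine LinearMap.ext_on hspan ?_
      rintro _ ⟨q, hq, x, y, rfl⟩
      change (ρ₀ (x * q * y)).trace = _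
      have hqi := (hF q hq).isStarProjection.isIdempotentElem
      have hc : q * (y * x) * q ∈ corner q :=
        (mem_corner hqi).mpr ⟨by simp only [← mul_assoc, hqi.eq], by rw [mul_assoc _ q q, hqi.eq]⟩
      obtain ⟨r, s, -, hs, hrs⟩ := (hF q hq).exists_eq_smul_add_skew hc
      rw [htr₀, Finset.sum_eq_single ⟨q, hq⟩]
      · rw [hcyc ⟨q, hq⟩ ⟨q, hq⟩]
        change _ * (σ ⟨q, hq⟩ (q * (y * x) * q)).trace = _
        have h1 : (σ ⟨q, hq⟩ s).trace = 0 := by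
          have h2 := hσs ⟨q, hq⟩ s
          have h3 := congrArg Matrix.trace h2
          rw [hs, map_neg, Matrix.trace_neg, Matrix.trace_transpose] at h3
          linarith
        have h2 : τ s = 0 := by
          have h3 := hτ.map_star s
          rw [hs, map_neg] at h3
          linarith
        have h3 : τ (x * q * y) = τ (q * (y * x) * q) := by
          rw [hτ.map_mul_comm (q * (y * x)), ← mul_assoc q q, hqi.eq, hτ.map_mul_comm (x * q),
            hτ.map_mul_comm q, mul_assoc]
        rw [h3, hrs, map_add, map_add, map_smul, map_smul, Matrix.trace_add, Matrix.trace_smul, h1,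
          h2, hσp, hk ⟨q, hq⟩, smul_eq_mul, smul_eq_mul]
        ring
      · intro p _ hpq
        have : σ p q = 0 := hσq p q fun b =>
          hFF q hq p p.2 (fun h => hpq (Subtype.ext h.symm)) b
        rw [map_mul, map_mul, this]
        simp
      · simp
    intro x
    exact LinearMap.congr_fun this x
  have hcard : Fintype.card ι = n := by
    have := htr 1
    rw [map_one, Matrix.trace_one, hn] at this
    exact_mod_cast this
  let e : ι ≃ Fin n := Fintype.equivFinOfCardEq hcard
  refine ⟨(Matrix.reindexAlgEquiv ℝ ℝ e).toAlgHom.comp ρ₀, fun x => ?_, fun x => ?_⟩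
  · change Matrix.reindex e e (ρ₀ (star x)) = (Matrix.reindex e e (ρ₀ x)).transpose
    rw [hstar, Matrix.transpose_reindex]
  · change (Matrix.reindex e e (ρ₀ x)).trace = _
    rw [← htr, Matrix.trace, Matrix.trace, ← e.symm.sum_comp]
    rfl

end IsFaithfulTrace

/-- A positive tracial functional on a real algebra with involution factors through a faithful
trace on a quotient. -/
theorem exists_quotient_isFaithfulTrace {A : Type} [Ring A] [StarRing A] [Algebra ℝ A]
    [StarModule ℝ A] (τ : A →ₗ[ℝ] ℝ) (hcomm : ∀ x y, τ (x * y) = τ (y * x))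
    (hstar : ∀ x, τ (star x) = τ x) (hpos : ∀ x, 0 ≤ τ (x * star x)) :
    ∃ (B : Type) (_ : Ring B) (_ : StarRing B) (_ : Algebra ℝ B) (_ : StarModule ℝ B)
      (π : A →ₐ[ℝ] B) (τ' : B →ₗ[ℝ] ℝ), Function.Surjective π ∧ (∀ x, π (star x) = star (π x)) ∧
      (∀ x, τ' (π x) = τ x) ∧ IsFaithfulTrace τ' := by
  let I : Ideal A :=
    { carrier := {x | ∀ b, τ (x * b) = 0}
      zero_mem' := fun b => by simp
      add_mem' := fun {x y} hx hy b => by rw [add_mul, map_add, hx, hy, add_zero]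
      smul_mem' := fun c x hx b => by
        rw [smul_eq_mul, mul_assoc, hcomm, mul_assoc, hx] }
  have hI : ∀ x, x ∈ I ↔ ∀ b, τ (x * b) = 0 := fun _ => Iff.rfl
  have : I.IsTwoSided := ⟨fun {a} b ha c => by rw [mul_assoc]; exact ha _⟩
  have hIstar : ∀ x ∈ I, star x ∈ I := fun x hx b => by
    rw [← hstar, star_mul, star_star, hcomm, hx]
  let mk := Ideal.Quotient.mk I
  have hmk : Function.Surjective mk := Ideal.Quotient.mk_surjective
  have hker : ∀ x y, mk x = mk y ↔ x - y ∈ I := fun x y => Ideal.Quotient.eq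
  obtain ⟨r, hr⟩ := hmk.hasRightInverse
  have hst : ∀ x, mk (star (r (mk x))) = mk (star x) := fun x => by
    rw [hker, ← star_sub]
    exact hIstar _ ((hker _ _).mp (hr _))
  have hτ : ∀ x, τ (r (mk x)) = τ x := fun x => by
    have := (hI _).mp ((hker _ _).mp (hr (mk x))) 1
    rwa [mul_one, map_sub, sub_eq_zero] at this
  let sB : StarRing (A ⧸ I) :=
    { star := fun x => mk (star (r x))
      star_involutive := fun x => by
        obtain ⟨x, rfl⟩ := hmk x
        change mk (star (r (mk (star (r (mk x)))))) = _
        rw [hst, star_star, hr]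
      star_mul := fun x y => by
        obtain ⟨x, rfl⟩ := hmk x
        obtain ⟨y, rfl⟩ := hmk y
        rw [← map_mul]
        change mk (star (r (mk (x * y)))) = mk (star (r (mk y))) * mk (star (r (mk x)))
        rw [hst, hst, hst, star_mul, map_mul]
      star_add := fun x y => by
        obtain ⟨x, rfl⟩ := hmk x
        obtain ⟨y, rfl⟩ := hmk y
        rw [← map_add]
        change mk (star (r (mk (x + y)))) = mk (star (r (mk x))) + mk (star (r (mk y)))
        rw [hst, hst, hst, star_add, map_add] }
  have hsB : ∀ x, star (mk x) = mk (star x) := hst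
  have hsm : ∀ (c : ℝ) x, c • mk x = mk (c • x) := fun c x => rfl
  let τ' : A ⧸ I →ₗ[ℝ] ℝ :=
    { toFun := fun x => τ (r x)
      map_add' := fun x y => by
        obtain ⟨x, rfl⟩ := hmk x
        obtain ⟨y, rfl⟩ := hmk y
        rw [← map_add, hτ, hτ, hτ, map_add]
      map_smul' := fun c x => by
        obtain ⟨x, rfl⟩ := hmk x
        rw [hsm, hτ, hτ, map_smul]; rfl }
  have hτ' : ∀ x, τ' (mk x) = τ x := hτ
  refine ⟨A ⧸ I, inferInstance, sB, inferInstance, ⟨fun c x => ?_⟩, Ideal.Quotient.mkₐ ℝ I, τ',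
    hmk, fun x => (hsB x).symm, hτ', ⟨fun x y => ?_, fun x => ?_, fun x hx => ?_⟩⟩
  · obtain ⟨x, rfl⟩ := hmk x
    rw [hsm, hsB, hsB, hsm, star_smul]
  · obtain ⟨x, rfl⟩ := hmk x
    obtain ⟨y, rfl⟩ := hmk y
    rw [← map_mul, ← map_mul, hτ', hτ', hcomm]
  · obtain ⟨x, rfl⟩ := hmk x
    rw [hsB, hτ', hτ', hstar]
  · obtain ⟨x, rfl⟩ := hmk x
    rw [hsB, ← map_mul, hτ']
    refine lt_of_le_of_ne (hpos x) fun h0 => hx ?_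
    rw [← map_zero mk, hker, sub_zero]
    intro b
    have key : ∀ t : ℝ, 0 ≤ t * (2 * τ (x * b)) + t ^ 2 * τ (star b * b) := fun t => by
      have h1 := hpos (x + t • star b)
      have h2 : τ (star b * star x) = τ (x * b) := by rw [← star_mul, hstar]
      rw [star_add, star_smul, star_star, mul_add, add_mul, add_mul, mul_smul_comm, mul_smul_comm,
        smul_mul_assoc, smul_mul_assoc, map_add, map_add, map_add, map_smul, map_smul, map_smul,
        map_smul, h2, ← h0, star_trivial] at h1
      simp only [smul_eq_mul] at h1
      linarith
    have hd : 0 ≤ τ (star b * b) := by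
      have := hpos (star b)
      rwa [star_star] at this
    by_contra hne
    have h1 := key (-τ (x * b) / (τ (star b * b) + 1))
    have h2 : (-τ (x * b) / (τ (star b * b) + 1)) * (2 * τ (x * b)) +
        (-τ (x * b) / (τ (star b * b) + 1)) ^ 2 * τ (star b * b) =
        -(τ (x * b) ^ 2 * (τ (star b * b) + 2)) / (τ (star b * b) + 1) ^ 2 := by
      field_simp
      ring
    rw [h2] at h1
    have h3 : 0 < τ (x * b) ^ 2 * (τ (star b * b) + 2) / (τ (star b * b) + 1) ^ 2 := by
      have : 0 < τ (x * b) ^ 2 := by positivity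
      positivity
    rw [neg_div] at h1
    linarith

namespace Matrix

/-- The Gram determinant of more than `card ι ^ 2` matrices for the trace form vanishes. -/
theorem det_trace_mul_transpose_eq_zero {ι κ R : Type*} [Fintype ι] [Fintype κ] [DecidableEq κ]
    [CommRing R] [IsDomain R] (x : κ → Matrix ι ι R)
    (hcard : Fintype.card ι * Fintype.card ι < Fintype.card κ) :
    (of fun i j => trace (x i * (x j)ᵀ)).det = 0 := by
  have hnot : ¬ LinearIndependent R x := fun hx => by
    have := hx.fintype_card_le_finrank
    rw [Module.finrank_matrix, Module.finrank_self, mul_one] at this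
    omega
  obtain ⟨v, hv, i, hi⟩ := Fintype.not_linearIndependent_iff.mp hnot
  refine exists_mulVec_eq_zero_iff.mp ⟨v, fun h => hi (congrFun h i), ?_⟩
  ext i
  have h1 : trace (x i * (∑ j, v j • x j)ᵀ) = 0 := by rw [hv]; simp
  rw [transpose_sum, Matrix.mul_sum, trace_sum] at h1
  rw [Pi.zero_apply, ← h1]
  refine Finset.sum_congr rfl fun j _ => ?_
  change trace (x i * (x j)ᵀ) * v j = _
  rw [transpose_smul, mul_smul_comm, trace_smul, smul_eq_mul, mul_comm]

end Matrix

theorem IsFaithfulTrace.map_pow_add_three {B : Type*} [Ring B] [StarRing B] [Algebra ℝ B]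
    {τ : B →ₗ[ℝ] ℝ} {p w : B} (hw : w * w = -p) (hwp : w * p = w) (i : ℕ) :
    τ (w ^ (i + 2 + 1)) = -τ (w ^ (i + 1)) := by
  rw [show i + 2 + 1 = i + 1 + 2 by ring, pow_add, pow_two, hw, mul_neg, pow_succ, mul_assoc, hwp,
    map_neg]

section TraceAlgebra

variable {ι R : Type} [Fintype ι] [DecidableEq ι] [CommRing R] [Algebra ℝ R]

/-- Positive real points of a trace algebra come from representations by real matrices. -/
theorem exists_representation_of_traceAlgebra [IsDomain R] [UniqueFactorizationMonoid R]
    [CharZero R] {n : ℕ} (hcard : Fintype.card ι = n) (A : Subalgebra ℝ (Matrix ι ι R)) (C : Subalgebra ℝ R) (χ : C →ₐ[ℝ] ℝ)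
    (hT : ∀ h ∈ A, hᵀ ∈ A) (htr : ∀ h ∈ A, trace h ∈ C)
    (hpos : ∀ h (hh : h ∈ A), 0 ≤ χ ⟨_, htr _ (A.mul_mem hh (hT h hh))⟩) :
    ∃ ρ : A →ₐ[ℝ] Matrix (Fin n) (Fin n) ℝ,
      (∀ x : A, ρ ⟨_, hT x x.2⟩ = (ρ x)ᵀ) ∧ ∀ x : A, trace (ρ x) = χ ⟨_, htr x x.2⟩ := by
  subst hcard
  let sA : StarRing A :=
    { star := fun x => ⟨_, hT x x.2⟩
      star_involutive := fun x => Subtype.ext (transpose_transpose _)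
      star_mul := fun x y => Subtype.ext (transpose_mul _ _)
      star_add := fun x y => Subtype.ext (transpose_add _ _) }
  have hsA : ∀ x : A, ((star x : A) : Matrix ι ι R) = (x : Matrix ι ι R)ᵀ := fun _ => rfl
  have : StarModule ℝ A := ⟨fun c x => Subtype.ext (transpose_smul _ _)⟩
  let τ : A →ₗ[ℝ] ℝ :=
    { toFun := fun x => χ ⟨_, htr x x.2⟩
      map_add' := fun x y => by
        rw [← map_add]
        exact congrArg χ (Subtype.ext (trace_add _ _))
      map_smul' := fun c x => by
        rw [RingHom.id_apply, ← map_smul]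
        exact congrArg χ (Subtype.ext (trace_smul _ _)) }
  have hτ : ∀ x : A, τ x = χ ⟨_, htr x x.2⟩ := fun _ => rfl
  obtain ⟨B, _, _, _, _, π, τ', hπ, hπs, hτ', hB⟩ := exists_quotient_isFaithfulTrace τ
    (fun x y => congrArg χ (Subtype.ext (trace_mul_comm _ _)))
    (fun x => congrArg χ (Subtype.ext (trace_transpose _))) (fun x => hpos x x.2)
  have hfd : FiniteDimensional ℝ B := by
    have hrank : Module.rank ℝ B ≤ (Fintype.card ι * Fintype.card ι : ℕ) := by
      refine rank_le fun s hs => ?_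
      classical
      by_contra! hlt
      obtain ⟨r, hr⟩ := hπ.hasRightInverse
      let G : Matrix s s C := of fun i j =>
        ⟨_, htr _ (A.mul_mem (r i).2 (hT _ (r (j : B)).2))⟩
      have hG : G.det = 0 := by
        apply Subtype.val_injective (p := (· ∈ C))
        change C.val G.det = C.val 0
        rw [map_zero, ← AlgHom.coe_toRingHom, RingHom.map_det]
        exact det_trace_mul_transpose_eq_zero (fun i : s => (r i : Matrix ι ι R)) (by simpa using hlt)
      have hχ : (χ.toRingHom.mapMatrix G).det = 0 := by rw [← RingHom.map_det, hG, map_zero]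
      obtain ⟨v, hv0, hv⟩ := exists_mulVec_eq_zero_iff.mpr hχ
      have hv' : ∀ i : s, τ' ((i : B) * star (∑ j : s, v j • (j : B))) = 0 := fun i => by
        have h1 := congrFun hv i
        rw [star_sum, Finset.mul_sum, map_sum]
        refine Eq.trans (Finset.sum_congr rfl fun j _ => ?_) h1
        rw [star_smul, star_trivial, mul_smul_comm, map_smul, smul_eq_mul, mul_comm]
        congr 1
        conv_lhs => rw [← hr i, ← hr j, ← hπs, ← map_mul, hτ']
        rfl
      have hb : ∑ j : s, v j • (j : B) = 0 := by
        by_contra hb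
        refine (hB.pos _ hb).ne' ?_
        conv_lhs => rw [Finset.sum_mul]
        rw [map_sum]
        refine Finset.sum_eq_zero fun j _ => ?_
        rw [smul_mul_assoc, map_smul, hv', smul_zero]
      exact hv0 (funext (Fintype.linearIndependent_iff.mp hs v hb))
    exact Module.rank_lt_aleph0_iff.mp (hrank.trans_lt Cardinal.natCast_lt_aleph0)
  have hpow : ∀ (x : A) (i : ℕ), ∃ hi : trace ((x : Matrix ι ι R) ^ i) ∈ C,
      χ ⟨_, hi⟩ = τ' (π x ^ i) := fun x i =>
    ⟨htr _ (A.pow_mem x.2 i), by rw [← map_pow, hτ']; rfl⟩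
  choose hpow_mem hpow using hpow
  have hskew : ∀ w : B, star w = -w → τ' w = 0 := fun w hw => by
    have := hB.map_star w
    rw [hw, map_neg] at this
    linarith
  have hlift : ∀ u : B, star u = -u → ∃ s : A, star s = -s ∧ π s = u := fun u hu => by
    obtain ⟨x, rfl⟩ := hπ u
    refine ⟨(2⁻¹ : ℝ) • (x - star x), ?_, ?_⟩
    · rw [star_smul, star_trivial, star_sub, star_star, ← smul_neg, neg_sub]
    · rw [map_smul, map_sub, hπs, hu]
      module
  have hright : ∀ p u : B, IsStarProjection p → star u = -u → p * u = u → u * p = u :=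
    fun p u hp hu hpu => by
      have := congrArg star hpu
      rwa [star_mul, hu, hp.isSelfAdjoint.star_eq, neg_mul, neg_inj] at this
  suffices h : ∃ ρ : B →ₐ[ℝ] Matrix (Fin (Fintype.card ι)) (Fin (Fintype.card ι)) ℝ,
      (∀ x, ρ (star x) = (ρ x)ᵀ) ∧ ∀ x, trace (ρ x) = τ' x by
    obtain ⟨ρ, hρs, hρt⟩ := h
    refine ⟨ρ.comp π, fun x => ?_, fun x => ?_⟩
    · exact (congrArg ρ (hπs x)).trans (hρs _)
    · exact (hρt _).trans (hτ' x)
  refine hB.exists_representation ?_ ?_ ?_ ?_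
  · rw [← map_one π, hτ', hτ]
    have : (⟨_, htr _ (1 : A).2⟩ : C) = ((Fintype.card ι : ℕ) : C) :=
      Subtype.ext (by simp)
    rw [this, map_natCast]
  · intro p hp
    obtain ⟨x, rfl⟩ := hπ p
    refine exists_nat_of_trace_pow_const C χ (x : Matrix ι ι R) _ fun i => ⟨hpow_mem x _, ?_⟩
    rw [hpow, hp.isIdempotentElem.pow_succ_eq]
  · intro p u hp hu hpu huu
    obtain ⟨x, rfl⟩ := hπ u
    refine exists_even_of_trace_pow C χ (x : Matrix ι ι R) _ (fun i => hpow_mem x _) ?_ ?_ ?_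
    · rw [hpow, zero_add, pow_one, hskew _ hu]
    · rw [hpow, one_add_one_eq_two, pow_two, huu, map_neg]
    · intro i
      rw [hpow, hpow, IsFaithfulTrace.map_pow_add_three huu (hright p _ hp hu hpu)]
  · intro p u v hp hu hv hpu hpv huu hvv huv
    have hup := hright p u hp hu hpu
    have hvp := hright p v hp hv hpv
    have hw : (u * v) * (u * v) = -p := by
      calc (u * v) * (u * v) = -((u * v) * (v * u)) := by rw [← mul_neg, ← huv]
        _ = -(u * (v * v) * u) := by simp only [mul_assoc]
        _ = -p := by rw [hvv, mul_neg, neg_mul, hup, huu, neg_neg]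
    have hwp : (u * v) * p = u * v := by rw [mul_assoc, hvp]
    have hsw : star (u * v) = -(u * v) := by rw [star_mul, hu, hv, neg_mul_neg, huv, neg_neg]
    obtain ⟨s, hs, rfl⟩ := hlift u hu
    obtain ⟨t, ht, rfl⟩ := hlift v hv
    rw [← map_mul] at hw hwp hsw
    refine exists_four_dvd_of_trace_pow C χ (s : Matrix ι ι R) (t : Matrix ι ι R)
      (congrArg Subtype.val hs) (congrArg Subtype.val ht) _ (fun i => hpow_mem (s * t) _) ?_ ?_ ?_
    · refine (hpow (s * t) _).trans ?_
      rw [zero_add, pow_one, hskew _ hsw]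
    · refine (hpow (s * t) _).trans ?_
      rw [one_add_one_eq_two, pow_two, hw, map_neg]
    · intro i
      refine (hpow (s * t) _).trans (Eq.trans ?_ (congrArg Neg.neg (hpow (s * t) _).symm))
      exact IsFaithfulTrace.map_pow_add_three hw hwp i

end TraceAlgebra

/-- Interpolation of a function on a finite set of reals by a polynomial. -/
theorem Polynomial.exists_eval_eq (s : Finset ℝ) (F : ℝ → ℝ) :
    ∃ f : Polynomial ℝ, ∀ x ∈ s, f.eval x = F x :=
  ⟨Lagrange.interpolate s id F, fun _ hx =>
    Lagrange.eval_interpolate_at_node F Function.injective_id.injOn hx⟩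

namespace Matrix

theorem transpose_aeval {n R : Type*} [Fintype n] [DecidableEq n] [CommRing R] [Algebra ℝ R]
    (h : Matrix n n R) (f : Polynomial ℝ) :
    (Polynomial.aeval h f)ᵀ = Polynomial.aeval hᵀ f := by
  simp only [Polynomial.aeval_eq_sum_range, transpose_sum, transpose_smul, transpose_pow]

theorem IsHermitian.exists_algEquiv_diagonal {n : Type*} [Fintype n] [DecidableEq n]
    {S : Matrix n n ℝ} (hS : S.IsHermitian) :
    ∃ e : Matrix n n ℝ ≃ₐ[ℝ] Matrix n n ℝ, (∀ x, trace (e x) = trace x) ∧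
      ∀ f : Polynomial ℝ, Polynomial.aeval S f = e (diagonal fun i => f.eval (hS.eigenvalues i)) := by
  let e := Unitary.conjStarAlgAut ℝ (Matrix n n ℝ) hS.eigenvectorUnitary
  refine ⟨e.toAlgEquiv, fun x => ?_, fun f => ?_⟩
  · change trace (e x) = _
    rw [Unitary.conjStarAlgAut_apply, trace_mul_comm, ← mul_assoc]
    simp
  · have h1 : S = e.toAlgEquiv (diagonalAlgHom ℝ hS.eigenvalues) := hS.spectral_theorem
    conv_lhs => rw [h1]
    change Polynomial.aeval (e.toAlgEquiv.toAlgHom (diagonalAlgHom ℝ hS.eigenvalues)) f = _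
    rw [Polynomial.aeval_algHom_apply, Polynomial.aeval_algHom_apply]
    refine congrArg e ?_
    change diagonalAlgHom ℝ _ = diagonal _
    rw [diagonalAlgHom_apply]
    congr 1
    ext i
    simp

/-- A symmetric real matrix is positive semidefinite if its compressions by polynomials in it have
nonnegative trace. -/
theorem posSemidef_of_trace_aeval_nonneg {n : Type*} [Fintype n] [DecidableEq n]
    {S : Matrix n n ℝ} (hS : S.IsHermitian)
    (h : ∀ f : Polynomial ℝ, 0 ≤ trace (Polynomial.aeval S f * S * Polynomial.aeval S f)) :
    S.PosSemidef := by
  rw [hS.posSemidef_iff_eigenvalues_nonneg]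
  intro i
  by_contra hi
  obtain ⟨e, he, hf⟩ := hS.exists_algEquiv_diagonal
  obtain ⟨f, hf'⟩ := Polynomial.exists_eval_eq (Finset.univ.image hS.eigenvalues)
    (fun x => if x < 0 then 1 else 0)
  have h1 := h f
  rw [show Polynomial.aeval S f * S * Polynomial.aeval S f =
      Polynomial.aeval S (f * Polynomial.X * f) by simp, hf, he, trace_diagonal] at h1
  refine h1.not_gt (Finset.sum_neg' (fun j _ => ?_) ⟨i, Finset.mem_univ i, ?_⟩)
  all_goals
    rw [Polynomial.eval_mul, Polynomial.eval_mul, Polynomial.eval_X, hf' _ (Finset.mem_image_of_mem _ (Finset.mem_univ _))]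
  · split_ifs with h3
    · linarith
    · simp
  · have h3 : hS.eigenvalues i < 0 := not_le.mp hi
    simp [h3]

/-- A positive definite real matrix is a positive scalar plus the square of a polynomial in it. -/
theorem PosDef.exists_eq_smul_add_aeval_mul_self {n : Type*} [Fintype n] [DecidableEq n]
    {S : Matrix n n ℝ} (hS : S.PosDef) :
    ∃ ε : ℝ, 0 < ε ∧ ∃ f : Polynomial ℝ,
      S = ε • 1 + Polynomial.aeval S f * Polynomial.aeval S f := by
  obtain ⟨ε, hε, hle⟩ : ∃ ε : ℝ, 0 < ε ∧ ∀ i, ε ≤ hS.isHermitian.eigenvalues i := by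
    rcases isEmpty_or_nonempty n with hn | hn
    · exact ⟨1, one_pos, fun i => hn.elim i⟩
    · obtain ⟨i, hi⟩ := Finite.exists_min hS.isHermitian.eigenvalues
      exact ⟨_, hS.eigenvalues_pos i, hi⟩
  obtain ⟨e, -, hf⟩ := hS.isHermitian.exists_algEquiv_diagonal
  obtain ⟨f, hf'⟩ := Polynomial.exists_eval_eq (Finset.univ.image hS.isHermitian.eigenvalues)
    (fun x => √(x - ε))
  refine ⟨ε, hε, f, ?_⟩
  have h2 : S = Polynomial.aeval S Polynomial.X := (Polynomial.aeval_X (R := ℝ) S).symm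
  have h3 : ε • (1 : Matrix n n ℝ) + Polynomial.aeval S f * Polynomial.aeval S f =
      Polynomial.aeval S (Polynomial.C ε + f * f) := by
    simp [Algebra.algebraMap_eq_smul_one]
  refine h2.trans (Eq.trans ?_ h3.symm)
  rw [hf, hf]
  refine congrArg (fun d => e (diagonal d)) (funext fun i => ?_)
  rw [Polynomial.eval_X, Polynomial.eval_add, Polynomial.eval_C, Polynomial.eval_mul,
    hf' _ (Finset.mem_image_of_mem _ (Finset.mem_univ _)),
    Real.mul_self_sqrt (sub_nonneg.mpr (hle i))]
  ring

end Matrix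

section TraceRing

variable {n g : ℕ}

theorem genMat_mem_traceRing (j : Fin g) : genMat n g j ∈ traceRing n g :=
  Algebra.subset_adjoin (Or.inl (Or.inl ⟨j, rfl⟩))

theorem closure_genSet_le_traceRing {w : MatP n g} (hw : w ∈ Submonoid.closure (genSet n g)) :
    w ∈ traceRing n g :=
  Submonoid.closure_le (S := (traceRing n g).toSubmonoid).mpr
    (fun _ hx => Algebra.subset_adjoin (Or.inl hx)) hw

theorem transpose_mem_traceRing {h : MatP n g} (hh : h ∈ traceRing n g) :
    hᵀ ∈ traceRing n g := by
  refine Algebra.adjoin_induction (p := fun h _ => hᵀ ∈ traceRing n g) ?_ ?_ ?_ ?_ hh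
  · rintro x ((⟨j, rfl⟩ | ⟨j, rfl⟩) | ⟨w, hw, rfl⟩)
    · exact Algebra.subset_adjoin (Or.inl (Or.inr ⟨j, rfl⟩))
    · exact genMat_mem_traceRing j
    · rw [transpose_smul, transpose_one]
      exact Algebra.subset_adjoin (Or.inr ⟨w, hw, rfl⟩)
  · intro r
    rw [Algebra.algebraMap_eq_smul_one, transpose_smul, transpose_one]
    exact (traceRing n g).smul_mem (traceRing n g).one_mem r
  · intro x y _ _ hx hy
    rw [transpose_add]
    exact (traceRing n g).add_mem hx hy
  · intro x y _ _ hx hy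
    rw [transpose_mul]
    exact (traceRing n g).mul_mem hy hx

variable (n g) in
/-- The center of the trace ring, as a subalgebra of the polynomial ring. -/
def traceCenter : Subalgebra ℝ (PolyRing n g) where
  carrier := {p | p • (1 : MatP n g) ∈ traceRing n g}
  mul_mem' {p q} hp hq := by
    rw [Set.mem_ofPred_eq, ← mul_one (1 : MatP n g), ← smul_mul_smul_comm]
    exact (traceRing n g).mul_mem hp hq
  add_mem' {p q} hp hq := by
    rw [Set.mem_ofPred_eq, add_smul]
    exact (traceRing n g).add_mem hp hq
  algebraMap_mem' r := by
    rw [Set.mem_ofPred_eq, algebraMap_smul]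
    exact (traceRing n g).smul_mem (traceRing n g).one_mem r

theorem smul_mem_traceRing {p : PolyRing n g} (hp : p ∈ traceCenter n g) {h : MatP n g}
    (hh : h ∈ traceRing n g) : p • h ∈ traceRing n g := by
  rw [← one_mul h, ← smul_mul_assoc]
  exact (traceRing n g).mul_mem hp hh

/-- The trace ring is spanned over its center by words in the generic matrices and their
transposes. -/
theorem mem_span_of_mem_traceRing {h : MatP n g} (hh : h ∈ traceRing n g) :
    h ∈ Submodule.span (traceCenter n g)
      (Submonoid.closure (genSet n g) : Set (MatP n g)) := by
  set W : Set (MatP n g) := (Submonoid.closure (genSet n g) : Set (MatP n g)) with hW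
  suffices H : ∀ y ∈ Submodule.span (traceCenter n g) W,
      h * y ∈ Submodule.span (traceCenter n g) W by
    rw [← mul_one h]
    exact H 1 (Submodule.subset_span (Submonoid.one_mem _))
  refine Algebra.adjoin_induction (p := fun h _ => ∀ y ∈ Submodule.span (traceCenter n g) W,
      h * y ∈ Submodule.span (traceCenter n g) W) ?_ ?_ ?_ ?_ hh
  · rintro x (hx | ⟨w, hw, rfl⟩) y hy
    · induction hy using Submodule.span_induction with
      | mem w hw =>
        exact Submodule.subset_span (Submonoid.mul_mem _ (Submonoid.subset_closure hx) hw)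
      | zero => rw [mul_zero]; exact Submodule.zero_mem _
      | add y z _ _ hy hz => rw [mul_add]; exact Submodule.add_mem _ hy hz
      | smul c y _ hy => rw [mul_smul_comm]; exact Submodule.smul_mem _ c hy
    · rw [smul_mul_assoc, one_mul]
      exact Submodule.smul_mem _
        (⟨trace w, Algebra.subset_adjoin (Or.inr ⟨w, hw, rfl⟩)⟩ : traceCenter n g) hy
  · intro r y hy
    rw [Algebra.algebraMap_eq_smul_one, smul_mul_assoc, one_mul,
      ← algebraMap_smul (traceCenter n g) r y]
    exact Submodule.smul_mem _ _ hy
  · intro x y _ _ hx hy z hz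
    rw [add_mul]
    exact Submodule.add_mem _ (hx z hz) (hy z hz)
  · intro x y _ _ hx hy z hz
    rw [mul_assoc]
    exact hx _ (hy z hz)

theorem trace_mem_traceCenter {h : MatP n g} (hh : h ∈ traceRing n g) :
    trace h ∈ traceCenter n g := by
  have := mem_span_of_mem_traceRing hh
  clear hh
  induction this using Submodule.span_induction with
  | mem w hw => exact Algebra.subset_adjoin (Or.inr ⟨w, hw, rfl⟩)
  | zero => rw [trace_zero]; exact Subalgebra.zero_mem _
  | add y z _ _ hy hz =>
    rw [trace_add]
    exact Subalgebra.add_mem _ hy hz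
  | smul c y _ hy =>
    change trace ((c : PolyRing n g) • y) ∈ _
    rw [trace_smul]; exact Subalgebra.mul_mem _ c.2 hy

theorem evalMat_eq_mapMatrix (X : Fin g → Matrix (Fin n) (Fin n) ℝ) (h : MatP n g) :
    evalMat n g X h =
      (MvPolynomial.aeval (R := ℝ) fun v : Fin g × Fin n × Fin n => X v.1 v.2.1 v.2.2).mapMatrix h :=
  rfl

theorem evalMat_genMat (X : Fin g → Matrix (Fin n) (Fin n) ℝ) (j : Fin g) :
    evalMat n g X (genMat n g j) = X j := by
  ext a b
  simp [evalMat, genMat]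

theorem evalMat_transpose (X : Fin g → Matrix (Fin n) (Fin n) ℝ) (h : MatP n g) :
    evalMat n g X hᵀ = (evalMat n g X h)ᵀ := rfl

theorem evalMat_trace_smul_one (X : Fin g → Matrix (Fin n) (Fin n) ℝ) (h : MatP n g) :
    evalMat n g X (trace h • (1 : MatP n g)) = trace (evalMat n g X h) • 1 := by
  rw [evalMat, smul_one_eq_diagonal, smul_one_eq_diagonal, diagonal_map (map_zero _)]
  congr 1
  ext i
  simp [evalMat, trace]

end TraceRing

section Positivstellensatz

variable {n g : ℕ}

variable (n g) in
/-- The symmetric elements of the trace ring, as a module over its center. -/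
def symTraceRing : Submodule (traceCenter n g) (MatP n g) where
  carrier := {h | h ∈ traceRing n g ∧ hᵀ = h}
  zero_mem' := ⟨(traceRing n g).zero_mem, transpose_zero⟩
  add_mem' {x y} hx hy :=
    ⟨(traceRing n g).add_mem hx.1 hy.1, by rw [transpose_add, hx.2, hy.2]⟩
  smul_mem' c x hx := ⟨smul_mem_traceRing c.2 hx.1, by
    change ((c : PolyRing n g) • x)ᵀ = (c : PolyRing n g) • x
    rw [transpose_smul, hx.2]⟩

instance : AddCommGroup (symTraceRing n g) := Submodule.addCommGroup _

instance : Module (traceCenter n g) (symTraceRing n g) := Submodule.module _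

instance : SMul (traceCenter n g) (symTraceRing n g) := Module.toDistribMulAction.toSMul

instance : Module ℝ (symTraceRing n g) := Submodule.module' _

instance : IsScalarTower ℝ (traceCenter n g) (symTraceRing n g) :=
  ⟨fun r c v => Subtype.ext (smul_assoc r (c : PolyRing n g) (v : MatP n g))⟩

instance : Module (Subsemiring.sumSq (traceCenter n g)) (symTraceRing n g) :=
  Subsemiring.module _

theorem coe_smul_symTraceRing (c : traceCenter n g) (v : symTraceRing n g) :
    ((c • v : symTraceRing n g) : MatP n g) = (c : PolyRing n g) • (v : MatP n g) := rfl

theorem one_mem_symTraceRing : (1 : MatP n g) ∈ symTraceRing n g :=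
  ⟨(traceRing n g).one_mem, transpose_one⟩

namespace IsCyclicQM

variable {Q : Set (MatP n g)}

theorem mem_traceRing (hQ : IsCyclicQM n g Q) {q : MatP n g} (hq : q ∈ Q) : q ∈ traceRing n g :=
  (hQ.1 q hq).1

theorem transpose_eq (hQ : IsCyclicQM n g Q) {q : MatP n g} (hq : q ∈ Q) : qᵀ = q :=
  (hQ.1 q hq).2

theorem one_mem (hQ : IsCyclicQM n g Q) : 1 ∈ Q := hQ.2.1

theorem add_mem (hQ : IsCyclicQM n g Q) {a b : MatP n g} (ha : a ∈ Q) (hb : b ∈ Q) : a + b ∈ Q :=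
  hQ.2.2.1 a ha b hb

theorem conj_mem (hQ : IsCyclicQM n g Q) {h q : MatP n g} (hh : h ∈ traceRing n g) (hq : q ∈ Q) :
    h * q * hᵀ ∈ Q :=
  hQ.2.2.2.1 h hh q hq

theorem trace_smul_one_mem (hQ : IsCyclicQM n g Q) {q : MatP n g} (hq : q ∈ Q) :
    trace q • (1 : MatP n g) ∈ Q :=
  hQ.2.2.2.2 q hq

theorem mul_transpose_mem (hQ : IsCyclicQM n g Q) {h : MatP n g} (hh : h ∈ traceRing n g) :
    h * hᵀ ∈ Q := by
  simpa using hQ.conj_mem hh hQ.one_mem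

theorem zero_mem (hQ : IsCyclicQM n g Q) : 0 ∈ Q := by
  simpa using hQ.mul_transpose_mem (traceRing n g).zero_mem

theorem mul_self_smul_mem (hQ : IsCyclicQM n g Q) {c : PolyRing n g} (hc : c ∈ traceCenter n g)
    {q : MatP n g} (hq : q ∈ Q) : (c * c) • q ∈ Q := by
  have := hQ.conj_mem hc hq
  rwa [transpose_smul, transpose_one, smul_mul_assoc, one_mul, mul_smul_comm, mul_one,
    smul_smul] at this

theorem real_smul_mem (hQ : IsCyclicQM n g Q) {r : ℝ} (hr : 0 ≤ r) {q : MatP n g} (hq : q ∈ Q) :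
    r • q ∈ Q := by
  have := hQ.mul_self_smul_mem ((traceCenter n g).algebraMap_mem (√r)) hq
  rwa [← map_mul, Real.mul_self_sqrt hr, algebraMap_smul] at this

/-- A cyclic quadratic module as a module over the sums of squares of the center. -/
def toSubmodule (hQ : IsCyclicQM n g Q) :
    Submodule (Subsemiring.sumSq (traceCenter n g)) (symTraceRing n g) where
  carrier := {v | (v : MatP n g) ∈ Q}
  zero_mem' := hQ.zero_mem
  add_mem' hx hy := hQ.add_mem hx hy
  smul_mem' := by
    rintro ⟨c, hc⟩ ⟨q, hq'⟩ (hq : q ∈ Q)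
    change (c : PolyRing n g) • q ∈ Q
    rw [Subsemiring.mem_sumSq] at hc
    induction hc with
    | zero => simpa using hQ.zero_mem
    | sq_add c _ ih =>
      rw [Subalgebra.coe_add, add_smul]
      exact hQ.add_mem (hQ.mul_self_smul_mem c.2 hq) ih

theorem exists_smul_one_sub_mem (hQ : IsCyclicQM n g Q)
    (harch : ∀ h ∈ traceRing n g, ∃ ρ : ℚ, 0 < ρ ∧ (ρ : ℝ) • (1 : MatP n g) - h * hᵀ ∈ Q)
    {h : MatP n g} (hh : h ∈ traceRing n g) (hs : hᵀ = h) :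
    ∃ N : ℝ, N • (1 : MatP n g) - h ∈ Q := by
  obtain ⟨ρ, -, hρ⟩ := harch h hh
  have h1 := hQ.mul_transpose_mem ((traceRing n g).sub_mem (traceRing n g).one_mem hh)
  refine ⟨(1 + ρ) / 2, ?_⟩
  have h2 := hQ.real_smul_mem (r := 1 / 2) (by norm_num) (hQ.add_mem hρ h1)
  convert h2 using 1
  rw [transpose_sub, transpose_one, hs]
  have : (1 - h) * (1 - h) = 1 - (2 : ℝ) • h + h * h := by
    rw [two_smul]
    noncomm_ring
  rw [this]
  module

end IsCyclicQM

/-- A symmetric element of the trace ring whose powers have vanishing trace at `χ` is in the kernel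
of every state over `χ`. -/
theorem state_eq_zero_of_trace_pow_eq_zero {Q : Set (MatP n g)} (hQ : IsCyclicQM n g Q)
    {φ : symTraceRing n g →ₗ[ℝ] ℝ} {χ : traceCenter n g →ₐ[ℝ] ℝ}
    (hφ : ∀ (c : traceCenter n g) (v : symTraceRing n g), φ (c • v) = χ c * φ v)
    (hφ1 : φ ⟨1, one_mem_symTraceRing⟩ = 1) (hφQ : ∀ v : symTraceRing n g, (v : MatP n g) ∈ Q → 0 ≤ φ v)
    (q : symTraceRing n g) (hq : ∀ i, χ ⟨_, trace_mem_traceCenter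
      ((traceRing n g).pow_mem q.2.1 (i + 1))⟩ = 0) : φ q = 0 := by
  have hpow : ∀ i, (q : MatP n g) ^ i ∈ symTraceRing n g := fun i =>
    ⟨(traceRing n g).pow_mem q.2.1 i, by rw [transpose_pow, q.2.2]⟩
  obtain ⟨c, hc, hsum⟩ := exists_pow_eq_sum_of_trace_pow_eq_zero (traceCenter n g) χ
    (q : MatP n g) fun i => ⟨_, hq i⟩
  rw [Fintype.card_fin] at hc hsum
  have hlarge : ∀ k, φ ⟨_, hpow (n + k)⟩ = 0 := fun k => by
    have h1 : (⟨_, hpow (n + k)⟩ : symTraceRing n g) +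
        ∑ i ∈ Finset.range n, c i • ⟨_, hpow (i + k)⟩ = 0 := by
      apply Subtype.ext
      have h2 := congrArg (· * (q : MatP n g) ^ k) hsum
      simp only [add_mul, Finset.sum_mul, zero_mul, smul_mul_assoc, ← pow_add] at h2
      rw [Submodule.coe_add, Submodule.coe_sum]
      exact h2
    have h2 := congrArg φ h1
    rwa [map_add, map_sum, Finset.sum_eq_zero fun i hi => by
      rw [hφ, hc i (Finset.mem_range.mp hi), zero_mul], add_zero, map_zero] at h2
  have hdesc : ∀ m, φ ⟨_, hpow (2 ^ m)⟩ = 0 → φ q = 0 := by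
    intro m
    induction m with
    | zero =>
      intro h
      rw [← h]
      exact congrArg φ (Subtype.ext (by simp))
    | succ m ih =>
      intro h
      refine ih ?_
      set t := φ ⟨_, hpow (2 ^ m)⟩ with ht
      have h1 := hQ.mul_transpose_mem ((traceRing n g).sub_mem (hpow (2 ^ m)).1
        ((traceRing n g).smul_mem (traceRing n g).one_mem t))
      have h2 : ((q : MatP n g) ^ 2 ^ m - t • 1) * ((q : MatP n g) ^ 2 ^ m - t • 1)ᵀ =
          ((⟨_, hpow (2 ^ (m + 1))⟩ - (2 * t) • ⟨_, hpow (2 ^ m)⟩ + (t * t) • ⟨_, hpow 0⟩ :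
            symTraceRing n g) : MatP n g) := by
        change _ = (q : MatP n g) ^ 2 ^ (m + 1) - (2 * t) • (q : MatP n g) ^ 2 ^ m +
          (t * t) • (q : MatP n g) ^ 0
        rw [transpose_sub, transpose_smul, transpose_one, (hpow _).2, pow_succ 2 m, pow_mul, pow_two,
          pow_zero, sub_mul, mul_sub, mul_sub, smul_mul_assoc, mul_smul_comm, smul_mul_assoc, one_mul,
          mul_one, one_mul]
        module
      rw [h2] at h1
      have h3 := hφQ _ h1
      have h4 : φ ⟨_, hpow 0⟩ = 1 := (congrArg φ (Subtype.ext (pow_zero _))).trans hφ1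
      rw [map_add, map_sub φ ⟨_, hpow (2 ^ (m + 1))⟩, map_smul, map_smul, h, ← ht, h4, smul_eq_mul,
        smul_eq_mul] at h3
      nlinarith
  refine hdesc n ?_
  obtain ⟨k, hk⟩ := Nat.exists_eq_add_of_le (Nat.lt_two_pow_self (n := n)).le
  rw [← hlarge k]
  exact congrArg φ (Subtype.ext (by simp only [hk]))

end Positivstellensatz

section Positivstellensatz

variable {n g : ℕ}

/-- A representation of the trace ring whose trace comes from a character of the center is an
evaluation. -/
theorem eq_evalMat_of_trace_eq (ρ : traceRing n g →ₐ[ℝ] Matrix (Fin n) (Fin n) ℝ)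
    (χ : traceCenter n g →ₐ[ℝ] ℝ)
    (hρT : ∀ x : traceRing n g, ρ ⟨_, transpose_mem_traceRing x.2⟩ = (ρ x)ᵀ)
    (hρ : ∀ x : traceRing n g, trace (ρ x) = χ ⟨_, trace_mem_traceCenter x.2⟩) :
    ∃ X : Fin g → Matrix (Fin n) (Fin n) ℝ, ∀ x : traceRing n g, evalMat n g X x = ρ x := by
  have hscalar : ∀ {p : PolyRing n g} (hp : p ∈ traceCenter n g), ρ ⟨_, hp⟩ = χ ⟨p, hp⟩ • 1 := by
    intro p hp
    set P : traceRing n g := ⟨_, hp⟩ with hP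
    rw [← sub_eq_zero, ← trace_mul_conjTranspose_self_eq_zero_iff]
    set y : traceCenter n g := ⟨p, hp⟩ with hy
    have h1 : ρ P - χ y • 1 = ρ (P - χ y • 1) := by rw [map_sub, map_smul, map_one]
    rw [conjTranspose_eq_transpose_of_trivial, h1, ← hρT, ← map_mul, hρ]
    have h2 : (⟨_, trace_mem_traceCenter ((P - χ y • 1) *
        ⟨_, transpose_mem_traceRing (P - χ y • 1).2⟩).2⟩ : traceCenter n g) =
        n • ((y - algebraMap ℝ _ (χ y)) * (y - algebraMap ℝ _ (χ y))) := by
      apply Subtype.ext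
      change trace ((p • (1 : MatP n g) - χ y • 1) * (p • (1 : MatP n g) - χ y • 1)ᵀ) =
        n • ((p - algebraMap ℝ _ (χ y)) * (p - algebraMap ℝ _ (χ y)))
      rw [← algebraMap_smul (PolyRing n g) (χ y) (1 : MatP n g), ← sub_smul, transpose_smul,
        transpose_one, smul_mul_smul_comm, mul_one, trace_smul, trace_one, Fintype.card_fin,
        smul_eq_mul, nsmul_eq_mul, mul_comm]
    rw [h2, map_nsmul, map_mul, map_sub, AlgHom.commutes]
    simp
  refine ⟨fun j => ρ ⟨_, genMat_mem_traceRing j⟩, ?_⟩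
  set X : Fin g → Matrix (Fin n) (Fin n) ℝ := fun j => ρ ⟨_, genMat_mem_traceRing j⟩ with hX
  have hgen : ∀ x (hx : x ∈ genSet n g), evalMat n g X x =
      ρ ⟨x, closure_genSet_le_traceRing (Submonoid.subset_closure hx)⟩ := by
    rintro x (⟨j, rfl⟩ | ⟨j, rfl⟩)
    · exact evalMat_genMat X j
    · rw [evalMat_transpose, evalMat_genMat]
      exact (hρT ⟨_, genMat_mem_traceRing j⟩).symm
  have hword : ∀ w (hw : w ∈ Submonoid.closure (genSet n g)), evalMat n g X w =
      ρ ⟨w, closure_genSet_le_traceRing hw⟩ := by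
    intro w hw
    induction hw using Submonoid.closure_induction with
    | mem x hx => exact hgen x hx
    | one => rw [evalMat_eq_mapMatrix, map_one]; exact (map_one ρ).symm
    | mul x y hx hy ihx ihy =>
      rw [evalMat_eq_mapMatrix, map_mul, ← evalMat_eq_mapMatrix, ← evalMat_eq_mapMatrix, ihx, ihy,
        ← map_mul]
      rfl
  rintro ⟨x, hx⟩
  induction hx using Algebra.adjoin_induction with
  | mem x hx =>
    rcases hx with hx | ⟨w, hw, rfl⟩
    · exact hgen x hx
    · rw [evalMat_trace_smul_one, hword w hw, hρ]
      exact (hscalar (trace_mem_traceCenter (closure_genSet_le_traceRing hw))).symm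
  | algebraMap r =>
    rw [evalMat_eq_mapMatrix, AlgHom.commutes]
    exact (ρ.commutes r).symm
  | add x y hx hy ihx ihy =>
    rw [evalMat_eq_mapMatrix] at ihx ihy ⊢
    rw [map_add, ihx, ihy, ← map_add]
    rfl
  | mul x y hx hy ihx ihy =>
    rw [evalMat_eq_mapMatrix] at ihx ihy ⊢
    rw [map_mul, ihx, ihy, ← map_mul]
    rfl

theorem transpose_aeval_traceRing {x : traceRing n g} (hx : (x : MatP n g)ᵀ = x)
    (f : Polynomial ℝ) :
    ((Polynomial.aeval x f : traceRing n g) : MatP n g)ᵀ = (Polynomial.aeval x f : traceRing n g) := by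
  have h1 : ((Polynomial.aeval x f : traceRing n g) : MatP n g) =
      Polynomial.aeval (x : MatP n g) f :=
    (Polynomial.aeval_algHom_apply (traceRing n g).val x f).symm
  rw [h1, transpose_aeval, hx]

/-- Elements outside an archimedean cyclic quadratic module are separated from it by a state which is
multiplicative along the center. -/
theorem IsCyclicQM.exists_pure_state {Q : Set (MatP n g)} (hQ : IsCyclicQM n g Q)
    (harch : ∀ h ∈ traceRing n g, ∃ ρ : ℚ, 0 < ρ ∧ (ρ : ℝ) • (1 : MatP n g) - h * hᵀ ∈ Q)
    (a : symTraceRing n g) (ha : (a : MatP n g) ∉ Q) :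
    ∃ (φ : symTraceRing n g →ₗ[ℝ] ℝ) (χ : traceCenter n g →ₐ[ℝ] ℝ),
      (∀ (c : traceCenter n g) (v : symTraceRing n g), φ (c • v) = χ c * φ v) ∧
      φ ⟨1, one_mem_symTraceRing⟩ = 1 ∧
      (∀ v : symTraceRing n g, (v : MatP n g) ∈ Q → 0 ≤ φ v) ∧ φ a ≤ 0 :=
  hQ.toSubmodule.exists_pure_state (u := ⟨1, one_mem_symTraceRing⟩) hQ.one_mem
    (fun v => hQ.exists_smul_one_sub_mem harch v.2.1 v.2.2) ha

end Positivstellensatz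

/-- Putinar's Positivstellensatz for trace polynomials. -/
theorem stmt4 (n g : ℕ) (hn : 0 < n) (hg : 0 < g)
    (Q : Set (MatP n g)) (hQ : IsCyclicQM n g Q)
    (harch : ∀ h ∈ traceRing n g, ∃ ρ : ℚ, 0 < ρ ∧
      (ρ : ℝ) • (1 : MatP n g) - h * hᵀ ∈ Q)
    (a : MatP n g) (haT : a ∈ traceRing n g) (haSym : aᵀ = a)
    (hpos : ∀ X ∈ KSet n g Q, (evalMat n g X a).PosDef) :
    a ∈ Q := by
  by_contra haQ
  obtain ⟨φ, χ, hφχ, hφ1, hφQ, hφa⟩ := hQ.exists_pure_state harch ⟨a, haT, haSym⟩ haQ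
  have htr : ∀ q (hq : q ∈ Q), 0 ≤ χ ⟨_, trace_mem_traceCenter (hQ.mem_traceRing hq)⟩ := by
    intro q hq
    set c : traceCenter n g := ⟨_, trace_mem_traceCenter (hQ.mem_traceRing hq)⟩
    have h1 : ((c • ⟨1, one_mem_symTraceRing⟩ : symTraceRing n g) : MatP n g) ∈ Q := by
      rw [coe_smul_symTraceRing]
      exact hQ.trace_smul_one_mem hq
    have h2 := hφQ _ h1
    rwa [hφχ, hφ1, mul_one] at h2
  obtain ⟨ρ, hρT, hρ⟩ := exists_representation_of_traceAlgebra (Fintype.card_fin n) (traceRing n g)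
    (traceCenter n g) χ (fun _ => transpose_mem_traceRing) (fun _ => trace_mem_traceCenter)
    fun h hh => htr _ (hQ.mul_transpose_mem hh)
  obtain ⟨X, hX⟩ := eq_evalMat_of_trace_eq ρ χ hρT hρ
  have hXK : X ∈ KSet n g Q := by
    intro q hq
    have hqs : (evalMat n g X q)ᵀ = evalMat n g X q := by
      rw [← evalMat_transpose, hQ.transpose_eq hq]
    have hqT := hQ.mem_traceRing hq
    refine posSemidef_of_trace_aeval_nonneg
      ((conjTranspose_eq_transpose_of_trivial _).trans hqs) fun f => ?_
    set b : traceRing n g := Polynomial.aeval ⟨q, hqT⟩ f with hb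
    have hbT : (b : MatP n g)ᵀ = b := transpose_aeval_traceRing (hQ.transpose_eq hq) f
    have h2 := htr _ (hQ.conj_mem b.2 hq)
    have h3 : Polynomial.aeval (evalMat n g X q) f = ρ b := by
      rw [hX ⟨q, hqT⟩, Polynomial.aeval_algHom_apply]
    rw [h3, hX ⟨q, hqT⟩, ← map_mul, ← map_mul, hρ]
    refine h2.trans_eq (congrArg χ (Subtype.ext ?_))
    change trace ((b : MatP n g) * q * (b : MatP n g)ᵀ) = trace ((b : MatP n g) * q * (b : MatP n g))
    rw [hbT]
  obtain ⟨ε, hε, f, hf⟩ := (hpos X hXK).exists_eq_smul_add_aeval_mul_self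
  set b : traceRing n g := Polynomial.aeval ⟨a, haT⟩ f with hb
  have hbT : (b : MatP n g)ᵀ = b := transpose_aeval_traceRing haSym f
  have hbb : (b : MatP n g) * b ∈ Q := by
    have := hQ.mul_transpose_mem b.2
    rwa [hbT] at this
  let bb : symTraceRing n g := ⟨_, hQ.mem_traceRing hbb, hQ.transpose_eq hbb⟩
  let q : symTraceRing n g := ⟨a, haT, haSym⟩ - ε • ⟨1, one_mem_symTraceRing⟩ - bb
  have hq0 : ρ ⟨q, q.2.1⟩ = 0 := by
    have h1 : (⟨q, q.2.1⟩ : traceRing n g) = ⟨a, haT⟩ - ε • 1 - b * b := rfl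
    rw [h1, map_sub, map_sub, map_smul, map_one, map_mul, hb, ← Polynomial.aeval_algHom_apply,
      ← hX ⟨a, haT⟩, sub_sub, sub_eq_zero]
    exact hf
  have hφq : φ q = 0 := state_eq_zero_of_trace_pow_eq_zero hQ hφχ hφ1 hφQ q
    fun i => by
      have h1 := hρ (⟨q, q.2.1⟩ ^ (i + 1))
      rw [map_pow, hq0, zero_pow i.succ_ne_zero, trace_zero] at h1
      exact h1.symm
  rw [map_sub, map_sub, map_smul, hφ1, smul_eq_mul, mul_one] at hφq
  have := hφQ bb hbb
  linarith
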